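/- arXiv:2305.09818 — 2 statements merged into one kernel-verified Lean document; each statement's English description precedes it below -/
import Mathlib

section
/- Let G be a group of F-type that admits a faithful representation into PSL(2,ℝ), and assume G is torsion-free or has only odd torsion (every element of finite order in G has odd order). Then G is CSA: every maximal abelian subgroup M of G is malnormal, i.e., gMg^{-1} ∩ M = {1} for all g ∈ G with g ∉ M. -/
open scoped MatrixGroups

namespace FPaper

/-- A (reduced) word in a free group is *cyclically reduced* if its first letter is not the
formal inverse of its last letter. -/
def CyclicallyReduced {α : Type*} [DecidableEq α] (w : FreeGroup α) : Prop :=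
  ∀ x y : α × Bool, w.toWord.head? = some x → w.toWord.getLast? = some y →
    x.1 = y.1 → x.2 = y.2

/-- The combinatorial data of a presentation of F-type:
`⟨a_1, …, a_n ∣ a_1^{e_1} = ⋯ = a_n^{e_n} = U V = 1⟩` with
`U = U(a_1, …, a_p)` and `V = V(a_{p+1}, …, a_n)`. -/
structure FTypeBase where
  n : ℕ
  e : Fin n → ℕ
  p : ℕ
  U : FreeGroup (Fin n)
  V : FreeGroup (Fin n)

namespace FTypeBase

/-- Relators of the full F-type presentation. -/
def rels (D : FTypeBase) : Set (FreeGroup (Fin D.n)) :=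
  {w | ∃ i : Fin D.n, w = FreeGroup.of i ^ D.e i} ∪ {D.U * D.V}

/-- Relators presenting the first factor `G₁` (the generators `a_{p+1}, …, a_n` are killed), so
that `PresentedGroup D.rels1` is the free product of cyclics on `a_1, …, a_p`. -/
def rels1 (D : FTypeBase) : Set (FreeGroup (Fin D.n)) :=
  {w | ∃ i : Fin D.n, (i : ℕ) < D.p ∧ w = FreeGroup.of i ^ D.e i} ∪
    {w | ∃ i : Fin D.n, D.p ≤ (i : ℕ) ∧ w = FreeGroup.of i}

/-- Relators presenting the second factor `G₂` (the generators `a_1, …, a_p` are killed), so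
that `PresentedGroup D.rels2` is the free product of cyclics on `a_{p+1}, …, a_n`. -/
def rels2 (D : FTypeBase) : Set (FreeGroup (Fin D.n)) :=
  {w | ∃ i : Fin D.n, D.p ≤ (i : ℕ) ∧ w = FreeGroup.of i ^ D.e i} ∪
    {w | ∃ i : Fin D.n, (i : ℕ) < D.p ∧ w = FreeGroup.of i}

/-- The group presented by the F-type presentation. -/
abbrev Gp (D : FTypeBase) := PresentedGroup D.rels

/-- The first factor `G₁ = ⟨a_1, …, a_p ∣ a_1^{e_1} = ⋯ = a_p^{e_p} = 1⟩`. -/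
abbrev Gp1 (D : FTypeBase) := PresentedGroup D.rels1

/-- The second factor `G₂ = ⟨a_{p+1}, …, a_n ∣ a_{p+1}^{e_{p+1}} = ⋯ = a_n^{e_n} = 1⟩`. -/
abbrev Gp2 (D : FTypeBase) := PresentedGroup D.rels2

/-- The image of the word `U` in the first factor `G₁`. -/
def imgU1 (D : FTypeBase) : D.Gp1 := PresentedGroup.mk D.rels1 D.U

/-- The image of the word `V` in the second factor `G₂`. -/
def imgV2 (D : FTypeBase) : D.Gp2 := PresentedGroup.mk D.rels2 D.V

/-- The conditions making an F-type presentation: `n ≥ 2`; each `e_i` is `0` or `≥ 2`;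
`1 ≤ p ≤ n - 1`; `U` is a cyclically reduced word in `a_1, …, a_p` of infinite order in `G₁`;
`V` is a cyclically reduced word in `a_{p+1}, …, a_n` of infinite order in `G₂`; and if
`p = 1` (resp. `p = n - 1`) then `U = a_1^m` (resp. `V = a_n^m`) for some `m ≥ 2`. -/
def IsFType (D : FTypeBase) : Prop :=
  2 ≤ D.n ∧ (∀ i, D.e i = 0 ∨ 2 ≤ D.e i) ∧ 1 ≤ D.p ∧ D.p ≤ D.n - 1 ∧
  (∀ x ∈ D.U.toWord, (x.1 : ℕ) < D.p) ∧ (∀ x ∈ D.V.toWord, D.p ≤ (x.1 : ℕ)) ∧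
  CyclicallyReduced D.U ∧ CyclicallyReduced D.V ∧
  ¬ IsOfFinOrder D.imgU1 ∧ ¬ IsOfFinOrder D.imgV2 ∧
  (D.p = 1 → ∃ (i : Fin D.n) (m : ℕ), (i : ℕ) = 0 ∧ 2 ≤ m ∧ D.U = FreeGroup.of i ^ m) ∧
  (D.p = D.n - 1 → ∃ (i : Fin D.n) (m : ℕ), (i : ℕ) = D.n - 1 ∧ 2 ≤ m ∧ D.V = FreeGroup.of i ^ m)

/-- The subgroup of the F-type group generated by (the images of) `a_1, …, a_p`. -/
def factor1 (D : FTypeBase) : Subgroup D.Gp :=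
  Subgroup.closure {g | ∃ i : Fin D.n, (i : ℕ) < D.p ∧ g = PresentedGroup.of i}

/-- The subgroup of the F-type group generated by (the images of) `a_{p+1}, …, a_n`. -/
def factor2 (D : FTypeBase) : Subgroup D.Gp :=
  Subgroup.closure {g | ∃ i : Fin D.n, D.p ≤ (i : ℕ) ∧ g = PresentedGroup.of i}

/-- The amalgamated subgroup `A = ⟨U⟩ = ⟨V⟩` of the F-type group. -/
def amalg (D : FTypeBase) : Subgroup D.Gp :=
  Subgroup.zpowers (PresentedGroup.mk D.rels D.U)

end FTypeBase

/-- A group is *of F-type* if it is isomorphic to the group of some F-type presentation. -/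
def IsFTypeGroup (G : Type*) [Group G] : Prop :=
  ∃ D : FTypeBase, D.IsFType ∧ Nonempty (G ≃* D.Gp)

/-- An element of a group is a *proper power* if it equals `h ^ k` for some `k ≥ 2`. -/
def IsProperPower {G : Type*} [Group G] (g : G) : Prop :=
  ∃ (h : G) (k : ℕ), 2 ≤ k ∧ g = h ^ k

/-- A group is a *free product of cyclic groups* if it has a presentation in which every
relator is a power of a generator. -/
def IsFreeProductOfCyclics (H : Type*) [Group H] : Prop :=
  ∃ (ι : Type) (e : ι → ℕ),
    Nonempty (H ≃* PresentedGroup {w : FreeGroup ι | ∃ i : ι, w = FreeGroup.of i ^ e i})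

/-- A subgroup `K` of `H` is *malnormal* if `g K g⁻¹ ∩ K = {1}` for every `g ∉ K`. -/
def IsMalnormal {H : Type*} [Group H] (K : Subgroup H) : Prop :=
  ∀ g : H, g ∉ K → ∀ x ∈ K, g * x * g⁻¹ ∈ K → x = 1

end FPaper

namespace FPaper

section TreeLength

variable {G : Type*} [Group G]

/-- An integer-valued length function on a group whose associated left-invariant metric
`(g, h) ↦ ℓ (g⁻¹ * h)` satisfies the four-point condition of a tree. -/
structure IsTreeLength (ℓ : G → ℕ) : Prop where
  one : ℓ 1 = 0
  inv : ∀ g, ℓ g⁻¹ = ℓ g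
  four_point : ∀ g h k, ℓ k + ℓ (g⁻¹ * h) ≤ ℓ h + ℓ (g⁻¹ * k) ∨
    ℓ k + ℓ (g⁻¹ * h) ≤ ℓ g + ℓ (k⁻¹ * h)

namespace IsTreeLength

variable {ℓ : G → ℕ}

theorem four_point' (hℓ : IsTreeLength ℓ) (a b c e : G) :
    ℓ (a⁻¹ * b) + ℓ (c⁻¹ * e) ≤ ℓ (a⁻¹ * c) + ℓ (b⁻¹ * e) ∨
    ℓ (a⁻¹ * b) + ℓ (c⁻¹ * e) ≤ ℓ (a⁻¹ * e) + ℓ (c⁻¹ * b) := by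
  have h := hℓ.four_point (a⁻¹ * c) (a⁻¹ * e) (a⁻¹ * b)
  have h1 : (a⁻¹ * c)⁻¹ * (a⁻¹ * e) = c⁻¹ * e := by group
  have h2 : (a⁻¹ * c)⁻¹ * (a⁻¹ * b) = c⁻¹ * b := by group
  have h3 : (a⁻¹ * b)⁻¹ * (a⁻¹ * e) = b⁻¹ * e := by group
  rw [h1, h2, h3] at h
  exact h.symm

theorem dist_comm (hℓ : IsTreeLength ℓ) (a b : G) : ℓ (a⁻¹ * b) = ℓ (b⁻¹ * a) := by
  rw [← hℓ.inv]; congr 1; group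

theorem mul_le (hℓ : IsTreeLength ℓ) (a b : G) : ℓ (a * b) ≤ ℓ a + ℓ b := by
  have h := hℓ.four_point' a⁻¹ b 1 1
  simp only [inv_inv, inv_one, mul_one, one_mul, hℓ.one, hℓ.inv] at h
  omega

theorem pow_eq (hℓ : IsTreeLength ℓ) {x : G} (hx : ℓ (x ^ 2) = 2 * ℓ x) (n : ℕ) :
    ℓ (x ^ n) = n * ℓ x := by
  have key : ∀ n : ℕ, ℓ (x ^ (n + 1)) = (n + 1) * ℓ x ∧ ℓ (x ^ (n + 2)) = (n + 2) * ℓ x := by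
    intro n
    induction n with
    | zero => simpa using hx
    | succ n ih =>
      refine ⟨ih.2, ?_⟩
      have h := hℓ.four_point' 1 (x ^ (n + 2)) x (x ^ (n + 3))
      have e1 : x⁻¹ * x ^ (n + 3) = x ^ (n + 2) := by rw [pow_succ' x (n + 2)]; group
      have e2 : x⁻¹ * x ^ (n + 2) = x ^ (n + 1) := by rw [pow_succ' x (n + 1)]; group
      have e3 : (x ^ (n + 2))⁻¹ * x ^ (n + 3) = x := by rw [pow_succ x (n + 2)]; group
      have hle := hℓ.mul_le (x ^ (n + 2)) x
      have e4 : x ^ (n + 2) * x = x ^ (n + 3) := (pow_succ x (n + 2)).symm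
      rw [e4] at hle
      simp only [inv_one, one_mul, e1, e2, e3, ih.1, ih.2] at h hle
      change ℓ (x ^ (n + 3)) = _
      rcases Nat.eq_zero_or_pos (ℓ x) with hL | hL
      · simpa [hL] using hle
      · have m1 : (n + 1) * ℓ x = n * ℓ x + ℓ x := by ring
        have m2 : (n + 2) * ℓ x = n * ℓ x + 2 * ℓ x := by ring
        have m3 : (n + 1 + 2) * ℓ x = n * ℓ x + 3 * ℓ x := by ring
        rw [m1, m2] at h
        rw [m2] at hle
        rw [m3]
        omega
  cases n with
  | zero => simp [hℓ.one]
  | succ n => simpa using (key n).1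

/-- An element commuting with a hyperbolic element `x` whose axis passes through the base point
moves the base point along this axis. -/
theorem axis_add (hℓ : IsTreeLength ℓ) {x y : G} (hx : ℓ (x ^ 2) = 2 * ℓ x) (hxy : Commute x y)
    {N : ℕ} (hN : ℓ y < N * ℓ x) :
    ℓ (x ^ N * y) + ℓ (y⁻¹ * x ^ N) = 2 * (N * ℓ x) := by
  have hp := hℓ.pow_eq hx
  have hc : x ^ N * y = y * x ^ N := hxy.pow_left N
  have hc' : (x ^ N)⁻¹ * y = y * (x ^ N)⁻¹ := ((hxy.pow_left N).inv_left).eq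
  -- the points `x⁻ᴺ, y x⁻ᴺ, y, y xᴺ, xᴺ`
  have f1 := hℓ.four_point' (x ^ N)⁻¹ y (y * (x ^ N)⁻¹) (y * x ^ N)
  have f2 := hℓ.four_point' (x ^ N) y (x ^ N)⁻¹ (y * x ^ N)
  have t := hℓ.mul_le (x ^ N * y) (y⁻¹ * x ^ N)
  have e1 : ((x ^ N)⁻¹)⁻¹ * (y * (x ^ N)⁻¹) = y := by rw [← hc']; group
  have e2 : (y * (x ^ N)⁻¹)⁻¹ * (y * x ^ N) = x ^ (2 * N) := by rw [two_mul, pow_add]; group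
  have e3 : (y * (x ^ N)⁻¹)⁻¹ * y = x ^ N := by group
  have e4 : y⁻¹ * (y * x ^ N) = x ^ N := by group
  have e5 : (x ^ N)⁻¹ * (y * x ^ N) = y := by rw [← hc]; group
  have e6 : (x ^ N)⁻¹ * (x ^ N)⁻¹ = (x ^ (2 * N))⁻¹ := by rw [two_mul, pow_add]; group
  have e7 : ((x ^ N)⁻¹)⁻¹ * y = x ^ N * y := by rw [inv_inv]
  have e8 : (x ^ N * y) * (y⁻¹ * x ^ N) = x ^ (2 * N) := by rw [two_mul, pow_add]; group
  have e9 := hℓ.dist_comm (x ^ N) y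
  rw [e1, e2, e3, e4, e7] at f1
  rw [e4, e5, e6, e7, hℓ.inv, e9] at f2
  rw [e8] at t
  have e10 : 2 * N * ℓ x = 2 * (N * ℓ x) := by ring
  simp only [hp, e10] at f1 f2 t
  omega

theorem axis_cases (hℓ : IsTreeLength ℓ) {x y : G} (hx : ℓ (x ^ 2) = 2 * ℓ x) (hxy : Commute x y)
    {N : ℕ} (hN : ℓ y < N * ℓ x) :
    ℓ (x ^ N * y) = N * ℓ x + ℓ y ∨ ℓ (y⁻¹ * x ^ N) = N * ℓ x + ℓ y := by
  have h := hℓ.axis_add hx hxy hN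
  have hp := hℓ.pow_eq hx
  have f := hℓ.four_point' 1 y (x ^ N)⁻¹ (x ^ N)
  have e1 : ((x ^ N)⁻¹)⁻¹ * x ^ N = x ^ (2 * N) := by rw [two_mul, pow_add]; group
  have e2 : y⁻¹ * (x ^ N)⁻¹ = (x ^ N * y)⁻¹ := by group
  have e10 : 2 * N * ℓ x = 2 * (N * ℓ x) := by ring
  have t1 := hℓ.mul_le (x ^ N) y
  have t2 := hℓ.mul_le y⁻¹ (x ^ N)
  rw [e1] at f
  simp only [inv_one, one_mul, hℓ.inv, hp, e10] at f t1 t2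
  have e3 : ℓ ((x ^ N)⁻¹⁻¹ * y) = ℓ (x ^ N * y) := by rw [inv_inv]
  omega

theorem sq_eq_of_ahead (hℓ : IsTreeLength ℓ) {x y : G} (hx : ℓ (x ^ 2) = 2 * ℓ x)
    (hxy : Commute x y) {N : ℕ} (hN : ℓ y < N * ℓ x) (h : ℓ (x ^ N * y) = N * ℓ x + ℓ y) :
    ℓ (y ^ 2) = 2 * ℓ y := by
  have ha := hℓ.axis_add hx hxy hN
  have hp := hℓ.pow_eq hx
  have hc' : (x ^ N)⁻¹ * y = y * (x ^ N)⁻¹ := ((hxy.pow_left N).inv_left).eq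
  have hc : x ^ N * y = y * x ^ N := hxy.pow_left N
  have f := hℓ.four_point' (y * (x ^ N)⁻¹) (y ^ 2) 1 y
  have e1 : (y * (x ^ N)⁻¹)⁻¹ * y ^ 2 = x ^ N * y := by rw [sq]; group
  have e2 : (y * (x ^ N)⁻¹)⁻¹ * 1 = y⁻¹ * x ^ N := by rw [← hc']; group
  have e3 : (y ^ 2)⁻¹ * y = y⁻¹ := by rw [sq]; group
  have e4 : (y * (x ^ N)⁻¹)⁻¹ * y = x ^ N := by group
  rw [e1, e2, e3, e4] at f
  have t := hℓ.mul_le y y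
  rw [← sq] at t
  simp only [inv_one, one_mul, hp, hℓ.inv] at f
  omega

theorem le_of_conj (hℓ : IsTreeLength ℓ) {x y g : G} (hx : ℓ (x ^ 2) = 2 * ℓ x)
    (hy : ℓ (y ^ 2) = 2 * ℓ y) (hg : y = g * x * g⁻¹) : ℓ y ≤ ℓ x := by
  by_contra! hlt
  set n := 2 * ℓ g + 1
  have h1 := hℓ.pow_eq hx n
  have h2 := hℓ.pow_eq hy n
  have h3 : y ^ n = g * x ^ n * g⁻¹ := by rw [hg, conj_pow]
  have t1 := hℓ.mul_le (g * x ^ n) g⁻¹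
  have t2 := hℓ.mul_le g (x ^ n)
  rw [← h3, h2, hℓ.inv] at t1
  rw [h1] at t2
  have h4 : n * (ℓ x + 1) ≤ n * ℓ y := Nat.mul_le_mul_left _ hlt
  have h5 : n * (ℓ x + 1) = n * ℓ x + n := by ring
  omega

theorem length_eq_zero_of_ahead (hℓ : IsTreeLength ℓ) {x y : G} (hx : ℓ (x ^ 2) = 2 * ℓ x)
    (hxy : Commute x y) (heq : ℓ (y ^ 2) = 2 * ℓ y → ℓ y = ℓ x) {N : ℕ} (hN : ℓ y < N * ℓ x)
    (h : ℓ (x ^ N * y) = N * ℓ x + ℓ y) : ℓ (x⁻¹ * y) = 0 := by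
  have hxy' : ℓ y = ℓ x := heq (hℓ.sq_eq_of_ahead hx hxy hN h)
  have ha := hℓ.axis_add hx hxy hN
  have hp := hℓ.pow_eq hx
  have hNpos : 0 < N := by
    rcases Nat.eq_zero_or_pos N with h0 | h0
    · simp [h0] at hN
    · exact h0
  obtain ⟨M, rfl⟩ : ∃ M, N = M + 1 := ⟨N - 1, by omega⟩
  have f := hℓ.four_point' x y (x ^ (M + 1))⁻¹ (x ^ (M + 1))
  have e1 : ((x ^ (M + 1))⁻¹)⁻¹ * x ^ (M + 1) = x ^ (2 * (M + 1)) := by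
    rw [two_mul, pow_add]; group
  have e2 : ℓ (x⁻¹ * (x ^ (M + 1))⁻¹) = ℓ (x ^ (M + 2)) := by
    rw [← hℓ.inv]; congr 1; rw [pow_succ x (M + 1)]; group
  have e3 : x⁻¹ * x ^ (M + 1) = x ^ M := by rw [pow_succ' x M]; group
  rw [e1, e2, e3, inv_inv] at f
  have e4 : 2 * (M + 1) * ℓ x = 2 * (M * ℓ x) + 2 * ℓ x := by ring
  have e5 : (M + 1) * ℓ x = M * ℓ x + ℓ x := by ring
  have e6 : (M + 2) * ℓ x = M * ℓ x + 2 * ℓ x := by ring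
  simp only [hp, e4, e5, e6] at f ha h
  omega

/-- If a conjugate `y` of a hyperbolic element `x` commutes with `x`, then `y` agrees with `x` or
`x⁻¹` up to an element fixing the base point. -/
theorem length_eq_zero_of_commute_conj (hℓ : IsTreeLength ℓ) {x y g : G}
    (hx : ℓ (x ^ 2) = 2 * ℓ x) (hpos : 0 < ℓ x) (hxy : Commute x y) (hg : y = g * x * g⁻¹) :
    ℓ (x⁻¹ * y) = 0 ∨ ℓ (x * y) = 0 := by
  have hN : ℓ y < (ℓ y + 1) * ℓ x := by nlinarith
  have heq : ℓ (y ^ 2) = 2 * ℓ y → ℓ y = ℓ x := fun hy ↦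
    le_antisymm (hℓ.le_of_conj hx hy hg) (hℓ.le_of_conj (g := g⁻¹) hy hx (by rw [hg]; group))
  rcases hℓ.axis_cases hx hxy hN with h | h
  · exact Or.inl (hℓ.length_eq_zero_of_ahead hx hxy heq hN h)
  · right
    have h' := hℓ.length_eq_zero_of_ahead (y := y⁻¹) hx hxy.inv_right
      (by simpa only [inv_pow, hℓ.inv] using heq) (N := ℓ y + 1) (by rwa [hℓ.inv])
      (by rw [hℓ.inv, ← h]; congr 1; exact (hxy.inv_right).pow_left _)
    rwa [← mul_inv_rev, hℓ.inv, ← hxy.eq] at h'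

end IsTreeLength

end TreeLength

section Amalgam

variable {G ι : Type*} [Group G]

/-- `AltForm K H n i g` says that `g = s₁ * ⋯ * sₙ * h` with `h ∈ H`, where the letters lie in
`K iₖ` but not in `H`, consecutive letters have distinct indices, and `i` is the index of the
first letter (`none` if there is no letter). -/
inductive AltForm (K : ι → Subgroup G) (H : Subgroup G) : ℕ → Option ι → G → Prop
  | base {h : G} (hh : h ∈ H) : AltForm K H 0 none h
  | cons {n : ℕ} {j : Option ι} {i : ι} {s g : G} (hs : s ∈ K i) (hsH : s ∉ H)
      (hg : AltForm K H n j g) (hj : j ≠ some i) : AltForm K H (n + 1) (some i) (s * g)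

/-- The group `G` is the amalgamated product of the subgroups `K i` along the common
subgroup `H`: the `K i` generate `G` and nonempty alternating products do not lie in `H`. -/
structure IsAmalgam_s18 (K : ι → Subgroup G) (H : Subgroup G) : Prop where
  le : ∀ i, H ≤ K i
  closure_eq : Subgroup.closure (⋃ i, (K i : Set G)) = ⊤
  eq_zero : ∀ n i g, AltForm K H n i g → g ∈ H → n = 0

namespace AltForm

variable {K : ι → Subgroup G} {H : Subgroup G}

theorem mul_left_mem (hle : ∀ i, H ≤ K i) {n : ℕ} {i : Option ι} {h g : G} (hh : h ∈ H)
    (hg : AltForm K H n i g) : AltForm K H n i (h * g) := by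
  cases hg with
  | base hg => exact .base (H.mul_mem hh hg)
  | cons hs hsH hg hj =>
    rw [← mul_assoc]
    exact .cons ((K _).mul_mem (hle _ hh) hs) (by rwa [H.mul_mem_cancel_left hh]) hg hj

theorem single {i : ι} {s : G} (hs : s ∈ K i) (hsH : s ∉ H) : AltForm K H 1 (some i) s := by
  simpa using AltForm.cons hs hsH (.base H.one_mem) (by simp)

theorem exists_of_mem {i : ι} {s : G} (hs : s ∈ K i) :
    ∃ n j, n ≤ 1 ∧ AltForm K H n j s := by
  by_cases hsH : s ∈ H
  · exact ⟨0, none, by omega, .base hsH⟩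
  · exact ⟨1, some i, le_rfl, .single hs hsH⟩

theorem exists_mul_left (hle : ∀ i, H ≤ K i) {n : ℕ} {j : Option ι} {i : ι} {t g : G}
    (ht : t ∈ K i) (hg : AltForm K H n j g) : ∃ m k, AltForm K H m k (t * g) := by
  by_cases htH : t ∈ H
  · exact ⟨n, j, hg.mul_left_mem hle htH⟩
  by_cases hj : j = some i
  · subst hj
    cases hg with
    | @cons n j i s g hs hsH hg hj =>
      rw [← mul_assoc]
      by_cases htsH : t * s ∈ H
      · exact ⟨n, j, hg.mul_left_mem hle htsH⟩
      · exact ⟨n + 1, some i, .cons ((K i).mul_mem ht hs) htsH hg hj⟩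
  · exact ⟨n + 1, some i, .cons ht htH hg hj⟩

/-- The concatenation of the forms of `g⁻¹` and `k` is reduced if the forms of `g` and `k` begin
with distinct indices. -/
theorem inv_mul (hle : ∀ i, H ≤ K i) {n m : ℕ} {i j : Option ι} {g k : G}
    (hg : AltForm K H n i g) (hk : AltForm K H m j k) (hij : i = none ∨ i ≠ j) :
    ∃ l, AltForm K H (n + m) l (g⁻¹ * k) := by
  induction hg generalizing m j k with
  | base hh => exact ⟨j, by simpa using hk.mul_left_mem hle (H.inv_mem hh)⟩
  | @cons n i' i s g hs hsH hg hj ih =>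
    have hk' : AltForm K H (m + 1) (some i) (s⁻¹ * k) :=
      .cons ((K i).inv_mem hs) (by rwa [inv_mem_iff]) hk (by rcases hij with h | h <;> grind)
    obtain ⟨l, hl⟩ := ih hk' (Or.inr hj)
    refine ⟨l, ?_⟩
    rw [mul_inv_rev, mul_assoc, add_assoc, add_comm 1 m]
    exact hl

theorem inv_mul_of_eq (hle : ∀ i, H ≤ K i) {n m : ℕ} {i : ι} {j j' : Option ι} {s t g k : G}
    (hs : s ∈ K i) (ht : t ∈ K i) (hst : s⁻¹ * t ∉ H) (hg : AltForm K H n j g)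
    (hj : j ≠ some i) (hk : AltForm K H m j' k) (hj' : j' ≠ some i) :
    ∃ l, AltForm K H (n + m + 1) l ((s * g)⁻¹ * (t * k)) := by
  have := hg.inv_mul hle (.cons ((K i).mul_mem ((K i).inv_mem hs) ht) hst hk hj') (Or.inr hj)
  rw [show (s * g)⁻¹ * (t * k) = g⁻¹ * (s⁻¹ * t * k) by group]
  exact this

end AltForm

namespace IsAmalgam_s18

variable {K : ι → Subgroup G} {H : Subgroup G}

theorem exists_altForm (hA : IsAmalgam_s18 K H) (g : G) : ∃ n i, AltForm K H n i g := by
  have hg : g ∈ Subgroup.closure (⋃ i, (K i : Set G)) := by rw [hA.closure_eq]; trivial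
  induction hg using Subgroup.closure_induction_left with
  | one => exact ⟨0, none, .base H.one_mem⟩
  | mul_left x hx y hy ih =>
    obtain ⟨i, hi⟩ := Set.mem_iUnion.1 hx
    obtain ⟨n, j, h⟩ := ih
    exact h.exists_mul_left hA.le hi
  | inv_mul_cancel x hx y hy ih =>
    obtain ⟨i, hi⟩ := Set.mem_iUnion.1 hx
    obtain ⟨n, j, h⟩ := ih
    exact h.exists_mul_left hA.le ((K i).inv_mem hi)

theorem unique_of_inv_mul_mem (hA : IsAmalgam_s18 K H) {n m : ℕ} {i j : Option ι} {g k : G}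
    (hg : AltForm K H n i g) (hk : AltForm K H m j k) (h : g⁻¹ * k ∈ H) : n = m ∧ i = j := by
  induction hg generalizing m j k with
  | base hh =>
    have hkH : k ∈ H := by rwa [H.mul_mem_cancel_left (H.inv_mem hh)] at h
    have := hA.eq_zero _ _ _ hk hkH
    cases hk with
    | base => simp
    | cons => simp at this
  | @cons n i' i s g hs hsH hg hj ih =>
    by_cases hij : some i = j
    · subst hij
      cases hk with
      | @cons m j' i t k ht htH hk hj' =>
        by_cases hst : s⁻¹ * t ∈ H
        · have := ih (hk.mul_left_mem hA.le hst) (by convert h using 1; group)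
          simp [this.1]
        · obtain ⟨l, hl⟩ := AltForm.inv_mul_of_eq hA.le hs ht hst hg hj hk hj'
          have := hA.eq_zero _ _ _ hl h
          omega
    · obtain ⟨l, hl⟩ := (AltForm.cons hs hsH hg hj).inv_mul hA.le hk (Or.inr hij)
      have := hA.eq_zero _ _ _ hl h
      omega

/-- The syllable length of an element of an amalgamated product. -/
noncomputable def length (hA : IsAmalgam_s18 K H) (g : G) : ℕ := (hA.exists_altForm g).choose

theorem length_eq (hA : IsAmalgam_s18 K H) {n : ℕ} {i : Option ι} {g : G}
    (hg : AltForm K H n i g) : hA.length g = n := by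
  obtain ⟨j, hj⟩ := (hA.exists_altForm g).choose_spec
  exact (hA.unique_of_inv_mul_mem hj hg (by simp [H.one_mem])).1

theorem length_le_one (hA : IsAmalgam_s18 K H) {i : ι} {g : G} (hg : g ∈ K i) : hA.length g ≤ 1 := by
  obtain ⟨n, j, hn, h⟩ := AltForm.exists_of_mem (H := H) hg
  rwa [hA.length_eq h]

theorem length_eq_zero (hA : IsAmalgam_s18 K H) {g : G} : hA.length g = 0 ↔ g ∈ H := by
  constructor
  · intro h
    obtain ⟨n, i, hg⟩ := hA.exists_altForm g
    rw [hA.length_eq hg] at h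
    subst h
    cases hg
    assumption
  · exact fun h ↦ hA.length_eq (.base h)

theorem length_inv_mul_le (hA : IsAmalgam_s18 K H) {n m : ℕ} {i j : Option ι} {g k : G}
    (hg : AltForm K H n i g) (hk : AltForm K H m j k) :
    hA.length (g⁻¹ * k) ≤ n + m ∧ (i ≠ none → i = j → hA.length (g⁻¹ * k) + 1 ≤ n + m) := by
  induction hg generalizing m j k with
  | base hh => exact ⟨by simp [hA.length_eq (hk.mul_left_mem hA.le (H.inv_mem hh))], by simp⟩
  | @cons n i' i s g hs hsH hg hj ih =>
    by_cases hij : some i = j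
    · subst hij
      cases hk with
      | @cons m j' i t k ht htH hk hj' =>
        by_cases hst : s⁻¹ * t ∈ H
        · have := (ih (hk.mul_left_mem hA.le hst)).1
          rw [show g⁻¹ * (s⁻¹ * t * k) = (s * g)⁻¹ * (t * k) by group] at this
          exact ⟨by omega, fun _ _ ↦ by omega⟩
        · obtain ⟨l, hl⟩ := AltForm.inv_mul_of_eq hA.le hs ht hst hg hj hk hj'
          rw [hA.length_eq hl]
          exact ⟨by omega, fun _ _ ↦ by omega⟩
    · obtain ⟨l, hl⟩ := (AltForm.cons hs hsH hg hj).inv_mul hA.le hk (Or.inr hij)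
      rw [hA.length_eq hl]
      exact ⟨by omega, fun _ h ↦ absurd h hij⟩

theorem length_four_point (hA : IsAmalgam_s18 K H) {n m q : ℕ} {i j l : Option ι} {g h k : G}
    (hg : AltForm K H n i g) (hh : AltForm K H m j h) (hk : AltForm K H q l k) :
    q + hA.length (g⁻¹ * h) ≤ m + hA.length (g⁻¹ * k) ∨
      q + hA.length (g⁻¹ * h) ≤ n + hA.length (k⁻¹ * h) := by
  induction hg generalizing m q j l h k with
  | base hgH =>
    left
    rw [hA.length_eq (hh.mul_left_mem hA.le (H.inv_mem hgH)),
      hA.length_eq (hk.mul_left_mem hA.le (H.inv_mem hgH)), add_comm]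
  | @cons n i' i s g hs hsH hg hi' ih =>
    have hg' := AltForm.cons hs hsH hg hi'
    have hb := hA.length_inv_mul_le hg' hh
    by_cases hil : some i = l
    · subst hil
      by_cases hij : some i = j
      · subst hij
        have hb' := hb.2 (by simp) rfl
        cases hk with
        | @cons q l' i r k hr hrH hk hl' =>
          cases hh with
          | @cons m j' i t h ht htH hh hj' =>
            by_cases hsr : s⁻¹ * r ∈ H
            · by_cases hst : s⁻¹ * t ∈ H
              · have := ih (hh.mul_left_mem hA.le hst) (hk.mul_left_mem hA.le hsr)
                rw [show g⁻¹ * (s⁻¹ * t * h) = (s * g)⁻¹ * (t * h) by group,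
                  show g⁻¹ * (s⁻¹ * r * k) = (s * g)⁻¹ * (r * k) by group,
                  show (s⁻¹ * r * k)⁻¹ * (s⁻¹ * t * h) = (r * k)⁻¹ * (t * h) by group] at this
                omega
              · have hrt : r⁻¹ * t ∉ H := fun hrt ↦ hst <| by
                  convert H.mul_mem hsr hrt using 1; group
                obtain ⟨_, h1⟩ := AltForm.inv_mul_of_eq hA.le hr ht hrt hk hl' hh hj'
                rw [hA.length_eq h1]
                omega
            · obtain ⟨_, h1⟩ := AltForm.inv_mul_of_eq hA.le hs hr hsr hg hi' hk hl'
              rw [hA.length_eq h1]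
              omega
      · obtain ⟨_, h1⟩ := hk.inv_mul hA.le hh (Or.inr hij)
        rw [hA.length_eq h1]
        omega
    · obtain ⟨_, h1⟩ := hg'.inv_mul hA.le hk (Or.inr hil)
      rw [hA.length_eq h1]
      omega

theorem isTreeLength (hA : IsAmalgam_s18 K H) : IsTreeLength hA.length where
  one := hA.length_eq_zero.2 H.one_mem
  inv g := by
    have key : ∀ g, hA.length g⁻¹ ≤ hA.length g := fun g ↦ by
      obtain ⟨n, i, hg⟩ := hA.exists_altForm g
      have := (hA.length_inv_mul_le hg (.base H.one_mem)).1
      rw [hA.length_eq hg]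
      simpa using this
    exact le_antisymm (key g) (by simpa using key g⁻¹)
  four_point g h k := by
    obtain ⟨n, i, hg⟩ := hA.exists_altForm g
    obtain ⟨m, j, hh⟩ := hA.exists_altForm h
    obtain ⟨q, l, hk⟩ := hA.exists_altForm k
    rw [hA.length_eq hg, hA.length_eq hh, hA.length_eq hk]
    exact hA.length_four_point hg hh hk

/-- Every element is conjugate into `H` or some `K i`, or to a cyclically reduced element. -/
theorem exists_conj (hA : IsAmalgam_s18 K H) (x : G) : ∃ k : G, k * x * k⁻¹ ∈ H ∨
    (∃ i, k * x * k⁻¹ ∈ K i) ∨ (0 < hA.length (k * x * k⁻¹) ∧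
      hA.length ((k * x * k⁻¹) ^ 2) = 2 * hA.length (k * x * k⁻¹)) := by
  have hℓ := hA.isTreeLength
  induction hn : hA.length x using Nat.strong_induction_on generalizing x with
  | _ n IH =>
  obtain ⟨m, j, hx⟩ := hA.exists_altForm x
  obtain rfl : m = n := by rw [← hA.length_eq hx, hn]
  cases hx with
  | base hh => exact ⟨1, by simp [hh]⟩
  | @cons n j i s g hs hsH hg hj =>
    by_cases hsq : hA.length ((s * g) ^ 2) = 2 * hA.length (s * g)
    · exact ⟨1, Or.inr (Or.inr (by simp [hsq, hn]))⟩
    rcases Nat.eq_zero_or_pos n with rfl | hpos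
    · cases hg with
      | base hh => exact ⟨1, Or.inr (Or.inl ⟨i, by simpa using (K i).mul_mem hs (hA.le i hh)⟩)⟩
    have hgl := hA.length_eq hg
    have hsl := hA.length_eq (AltForm.single (K := K) hs hsH)
    have hle := hℓ.mul_le (s * g) (s * g)
    rw [← sq] at hle
    -- both `x⁻¹` and `x` start at `i`, hence so does `g⁻¹`
    have f1 := hℓ.four_point g⁻¹ s (s * g)⁻¹
    have f2 := hℓ.four_point (s * g)⁻¹ s (s * g)
    have e1 : (s * g)⁻¹⁻¹ * (s * g) = (s * g) ^ 2 := by rw [sq]; group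
    have e2 : (s * g)⁻¹ * s = g⁻¹ := by group
    have e3 : g⁻¹⁻¹ * (s * g)⁻¹ = s⁻¹ := by group
    rw [e1, e2] at f2
    rw [e3] at f1
    simp only [inv_inv, hℓ.inv, hn, hgl, hsl] at f1 f2 hle hsq
    obtain ⟨k, hk⟩ := IH (hA.length (g * s)) (by omega) (g * s) rfl
    refine ⟨k * s⁻¹, ?_⟩
    rwa [show k * s⁻¹ * (s * g) * (k * s⁻¹)⁻¹ = k * (g * s) * k⁻¹ by group]

theorem inf_le (hA : IsAmalgam_s18 K H) {i j : ι} (hij : i ≠ j) {s : G} (hi : s ∈ K i)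
    (hj : s ∈ K j) : s ∈ H := by
  by_contra hs
  have := (hA.unique_of_inv_mul_mem (AltForm.single (K := K) hi hs)
    (AltForm.single (K := K) hj hs) (by simp [H.one_mem])).2
  simp [hij] at this

/-- A malnormality criterion for the factors of an amalgamated product. -/
theorem mem_of_conj_mem (hA : IsAmalgam_s18 K H) {i : ι} {x : G} (hx : x ∈ K i)
    (hQ : ∀ z ∈ K i, z * x * z⁻¹ ∈ H → ∀ j ≠ i, ∀ s ∈ K j, s ∉ H → s * (z * x * z⁻¹) * s⁻¹ ∉ H)
    {y : G} (hy : y * x * y⁻¹ ∈ K i) : y ∈ K i := by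
  have key : ∀ n j w, AltForm K H n j w → j ≠ some i → ∀ z ∈ K i,
      w⁻¹ * (z * x * z⁻¹) * w ∈ K i → w ∈ K i := by
    intro n j w hw hj z hz hc
    cases hw with
    | base hh => exact hA.le i hh
    | @cons n j' j t w ht htH hw hj' =>
      exfalso
      have hji : j ≠ i := fun h ↦ hj (by rw [h])
      have hx' : z * x * z⁻¹ ∈ K i := (K i).mul_mem ((K i).mul_mem hz hx) ((K i).inv_mem hz)
      have hc1 := hA.length_le_one hc
      by_cases hxH : z * x * z⁻¹ ∈ H
      · have htx := hQ z hz hxH j hji t⁻¹ ((K j).inv_mem ht) (by rwa [inv_mem_iff])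
        rw [inv_inv] at htx
        have htK : t⁻¹ * (z * x * z⁻¹) * t ∈ K j :=
          (K j).mul_mem ((K j).mul_mem ((K j).inv_mem ht) (hA.le j hxH)) ht
        obtain ⟨l, hl⟩ := hw.inv_mul hA.le (.cons htK htx hw hj') (Or.inr hj')
        rw [show w⁻¹ * (t⁻¹ * (z * x * z⁻¹) * t * w) = (t * w)⁻¹ * (z * x * z⁻¹) * (t * w) by
          group] at hl
        rw [hA.length_eq hl] at hc1
        obtain rfl : n = 0 := by omega
        cases hw with
        | base hh =>
          have hwj := hA.le j hh
          have hcj : (t * w)⁻¹ * (z * x * z⁻¹) * (t * w) ∈ K j := by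
            have := (K j).mul_mem ((K j).mul_mem ((K j).inv_mem hwj) htK) hwj
            convert this using 1; group
          have := hA.eq_zero _ _ _ hl (hA.inf_le hji hcj hc)
          omega
      · have hw' := AltForm.cons ht htH hw hj'
        obtain ⟨l, hl⟩ := hw'.inv_mul hA.le (.cons hx' hxH hw' (by simpa using hji))
          (Or.inr (by simpa using hji))
        rw [← mul_assoc] at hl
        rw [hA.length_eq hl] at hc1
        omega
  obtain ⟨n, j, hw⟩ := hA.exists_altForm y⁻¹
  by_cases hj : j = some i
  · subst hj
    generalize hv : y⁻¹ = v at hw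
    obtain rfl : y = v⁻¹ := by rw [← hv, inv_inv]
    cases hw with
    | @cons n j i s w hs hsH hw hj =>
      have := key _ _ w hw hj s⁻¹ ((K i).inv_mem hs) (by convert hy using 1; group)
      exact (K i).inv_mem ((K i).mul_mem hs this)
  · have := key _ _ _ hw hj 1 (K i).one_mem (by simpa using hy)
    simpa using this

end IsAmalgam_s18

end Amalgam

section CommutativeTransitive

variable {G : Type*} [Group G]

/-- A group is commutative transitive if centralizers of nontrivial elements are abelian. -/
def IsCommTransitive (G : Type*) [Group G] : Prop :=
  ∀ x : G, x ≠ 1 → ∀ a b : G, Commute a x → Commute x b → Commute a b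

/-- In the group, an element commutes with `x` as soon as it conjugates `x` into the centralizer
of `x`. -/
def CommutesOfCommuteConj (G : Type*) [Group G] : Prop :=
  ∀ x g : G, Commute x (g * x * g⁻¹) → Commute g x

theorem IsCommTransitive.of_injective {G' : Type*} [Group G'] (hG : IsCommTransitive G)
    {f : G' →* G} (hf : Function.Injective f) : IsCommTransitive G' := by
  intro x hx a b hax hxb
  have := hG (f x) (by rwa [ne_eq, map_eq_one_iff f hf]) (f a) (f b) (hax.map f) (hxb.map f)
  exact hf (by simpa using this.eq)

theorem IsCommTransitive.eq_one_of_conj_eq_inv (hG : IsCommTransitive G)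
    (h2 : ∀ x : G, x * x = 1 → x = 1) {x g : G} (h : g * x * g⁻¹ = x⁻¹) : x = 1 := by
  have hgx : Commute (g * g) x := by
    rw [commute_iff_eq, ← mul_inv_eq_iff_eq_mul]
    have h' : g * x⁻¹ * g⁻¹ = x := by rw [← conj_inv, h, inv_inv]
    calc g * g * x * (g * g)⁻¹ = g * (g * x * g⁻¹) * g⁻¹ := by group
      _ = x := by rw [h, h']
  have hc : Commute g x := by
    by_cases hg : g * g = 1
    · rw [h2 g hg]; exact Commute.one_left x
    · exact hG _ hg g x ((Commute.refl g).mul_right (Commute.refl g)) hgx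
  apply h2
  rw [mul_inv_eq_iff_eq_mul.2 hc.eq] at h
  nth_rewrite 2 [h]
  exact mul_inv_cancel x

theorem commute_conj_conj {x g : G} (k : G) (h : Commute x (g * x * g⁻¹)) :
    Commute (k * x * k⁻¹) ((k * g * k⁻¹) * (k * x * k⁻¹) * (k * g * k⁻¹)⁻¹) := by
  have := (Commute.conj_iff k).2 h
  convert this using 1
  group

theorem IsCommTransitive.exists_mem_factor {ι : Type*} [Nonempty ι] {K : ι → Subgroup G}
    {H : Subgroup G} (hA : IsAmalgam_s18 K H) (hG : IsCommTransitive G)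
    (h2 : ∀ x : G, x * x = 1 → x = 1) {x g : G} (hx : Commute x (g * x * g⁻¹))
    (hgx : ¬ Commute g x) :
    ∃ i, ∃ x ∈ K i, ∃ g, Commute x (g * x * g⁻¹) ∧ ¬ Commute g x := by
  obtain ⟨k, hk⟩ := hA.exists_conj x
  have hx' := commute_conj_conj k hx
  have hgx' : ¬ Commute (k * g * k⁻¹) (k * x * k⁻¹) := by rwa [Commute.conj_iff]
  clear hx hgx
  generalize k * x * k⁻¹ = z at *
  generalize k * g * k⁻¹ = g at *
  rcases hk with hk | ⟨i, hk⟩ | ⟨hpos, hsq⟩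
  · exact ⟨Classical.arbitrary ι, z, hA.le _ hk, g, hx', hgx'⟩
  · exact ⟨i, z, hk, g, hx', hgx'⟩
  have hz1 : z ≠ 1 := by rintro rfl; exact hgx' (Commute.one_right g)
  -- it suffices to find a nontrivial element of `H` commuting with `z` and its conjugate
  have key : ∀ y ∈ H, y ≠ 1 → Commute z y → Commute y (g * z * g⁻¹) →
      ∃ i, ∃ x ∈ K i, ∃ g, Commute x (g * x * g⁻¹) ∧ ¬ Commute g x := by
    intro y hy hy1 hzy hyc
    refine ⟨Classical.arbitrary ι, y, hA.le _ hy, g, ?_, ?_⟩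
    · refine hG (g * z * g⁻¹) ?_ _ _ hyc ((Commute.conj_iff g).2 hzy)
      rwa [ne_eq, conj_eq_one_iff]
    · exact fun hgy ↦ hgx' (hG y hy1 g z hgy hzy.symm)
  rcases hA.isTreeLength.length_eq_zero_of_commute_conj hsq hpos hx' rfl with h | h
  · refine key _ (hA.length_eq_zero.1 h) ?_ ((Commute.refl z).inv_right.mul_right hx')
      (hx'.inv_left.mul_left (Commute.refl _))
    intro h1
    exact hgx' (mul_inv_eq_iff_eq_mul.1 (inv_mul_eq_one.1 h1).symm)
  · refine key _ (hA.length_eq_zero.1 h) ?_ ((Commute.refl z).mul_right hx')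
      (hx'.mul_left (Commute.refl _))
    intro h1
    exact hz1 (hG.eq_one_of_conj_eq_inv h2 (eq_inv_of_mul_eq_one_right h1))

theorem IsCommTransitive.commutesOfCommuteConj {ι : Type*} [Nonempty ι] {K : ι → Subgroup G}
    {H : Subgroup G} (hA : IsAmalgam_s18 K H) (hG : IsCommTransitive G)
    (h2 : ∀ x : G, x * x = 1 → x = 1)
    (hK : ∀ i, ∀ x ∈ K i, ∀ g ∈ K i, Commute x (g * x * g⁻¹) → Commute g x)
    (hmal : ∀ i, ∀ x ∈ K i, x ≠ 1 → ∃ k : G, ∃ i', k * x * k⁻¹ ∈ K i' ∧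
      ∀ y, y * (k * x * k⁻¹) * y⁻¹ ∈ K i' → y ∈ K i') :
    CommutesOfCommuteConj G := by
  intro x g hx
  by_contra hgx
  obtain ⟨i, x, hxi, g, hx, hgx⟩ := hG.exists_mem_factor hA h2 hx hgx
  have hx1 : x ≠ 1 := by rintro rfl; exact hgx (Commute.one_right g)
  obtain ⟨k, i', hk, hm⟩ := hmal i x hxi hx1
  have hx' := commute_conj_conj k hx
  have hgx' : ¬ Commute (k * g * k⁻¹) (k * x * k⁻¹) := by rwa [Commute.conj_iff]
  refine hgx' (hK i' _ hk _ (hm _ (hm _ ?_)) hx')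
  rwa [mul_inv_eq_iff_eq_mul.2 hx'.symm.eq]

/-- Free products of abelian groups. -/
theorem IsCommTransitive.commutesOfCommuteConj_of_bot {ι : Type*} [Nonempty ι]
    {K : ι → Subgroup G} (hA : IsAmalgam_s18 K ⊥) (hG : IsCommTransitive G)
    (h2 : ∀ x : G, x * x = 1 → x = 1) (hK : ∀ i, ∀ x ∈ K i, ∀ g ∈ K i, Commute g x) :
    CommutesOfCommuteConj G := by
  refine hG.commutesOfCommuteConj hA h2 (fun i x hx g hg _ ↦ hK i x hx g hg) ?_
  intro i x hx hx1
  refine ⟨1, i, by simpa using hx, fun y hy ↦ hA.mem_of_conj_mem hx ?_ (by simpa using hy)⟩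
  intro z _ hz
  rw [Subgroup.mem_bot, conj_eq_one_iff] at hz
  exact absurd hz hx1

/-- Amalgamated products of two groups along a subgroup that is malnormal in one of them. -/
theorem IsCommTransitive.commutesOfCommuteConj_of_malnormal {K : Bool → Subgroup G}
    {H : Subgroup G} (hA : IsAmalgam_s18 K H) (hG : IsCommTransitive G)
    (h2 : ∀ x : G, x * x = 1 → x = 1)
    (hK : ∀ i, ∀ x ∈ K i, ∀ g ∈ K i, Commute x (g * x * g⁻¹) → Commute g x) (b : Bool)
    (hb : ∀ s ∈ K b, ∀ h ∈ H, h ≠ 1 → s * h * s⁻¹ ∈ H → s ∈ H) :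
    CommutesOfCommuteConj G := by
  refine hG.commutesOfCommuteConj hA h2 hK ?_
  intro i x hx hx1
  by_cases hc : ∃ k : G, k * x * k⁻¹ ∈ K (!b)
  · obtain ⟨k, hk⟩ := hc
    refine ⟨k, !b, hk, fun y hy ↦ hA.mem_of_conj_mem hk ?_ hy⟩
    intro z _ hz j hj s hs hsH hmem
    obtain rfl : j = b := Bool.not_eq_not.1 hj
    refine hsH (hb s hs _ hz ?_ hmem)
    rwa [ne_eq, conj_eq_one_iff, conj_eq_one_iff]
  · refine ⟨1, i, by simpa using hx, fun y hy ↦ hA.mem_of_conj_mem hx ?_ (by simpa using hy)⟩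
    exact fun z _ hz ↦ absurd ⟨z, hA.le _ hz⟩ hc

/-- In an amalgamated product of two factors along `⟨u⟩` which is commutative transitive, the
centralizer of `u` in one of the factors is `⟨u⟩`. -/
theorem IsCommTransitive.exists_centralizer_le {K : Bool → Subgroup G} {H : Subgroup G}
    (hA : IsAmalgam_s18 K H) (hG : IsCommTransitive G) {u : G} (hu : u ≠ 1) :
    ∃ b, ∀ s ∈ K b, Commute s u → s ∈ H := by
  by_contra! h
  obtain ⟨s, hs, hsu, hsH⟩ := h true
  obtain ⟨t, ht, htu, htH⟩ := h false
  have hst := hG u hu s t hsu htu.symm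
  have h1 : AltForm K H (1 + 1) (some true) (s * t) :=
    .cons hs hsH (.single ht htH) (by simp)
  have h2 : AltForm K H (1 + 1) (some false) (t * s) :=
    .cons ht htH (.single hs hsH) (by simp)
  rw [← hst.eq] at h2
  simpa using (hA.unique_of_inv_mul_mem h1 h2 (by simp [H.one_mem])).2

theorem IsCommTransitive.commutesOfCommuteConj_of_zpowers {K : Bool → Subgroup G} {u : G}
    (hA : IsAmalgam_s18 K (Subgroup.zpowers u)) (hG : IsCommTransitive G)
    (h2 : ∀ x : G, x * x = 1 → x = 1) (hu : u ≠ 1)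
    (hK : ∀ i, ∀ x ∈ K i, ∀ g ∈ K i, Commute x (g * x * g⁻¹) → Commute g x) :
    CommutesOfCommuteConj G := by
  obtain ⟨b, hb⟩ := hG.exists_centralizer_le hA hu
  refine hG.commutesOfCommuteConj_of_malnormal hA h2 hK b ?_
  rintro s hs _ ⟨m, rfl⟩ hm ⟨n, hn⟩
  refine hb s hs (hG (u ^ m) hm s u ?_ ((Commute.refl u).zpow_left m))
  refine hK b _ (hA.le b ⟨m, rfl⟩) s hs ?_
  simp only at hn
  rw [← hn]
  exact (Commute.refl u).zpow_zpow m n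

theorem IsCommTransitive.isMalnormal (hG : IsCommTransitive G) (hC : CommutesOfCommuteConj G)
    {M : Subgroup G} (hM : ∀ x ∈ M, ∀ y ∈ M, x * y = y * x)
    (hmax : ∀ M' : Subgroup G, (∀ x ∈ M', ∀ y ∈ M', x * y = y * x) → M ≤ M' → M' = M) :
    IsMalnormal M := by
  intro g hg x hx hgx
  by_contra hx1
  have hcx : Commute g x := hC x g (hM x hx _ hgx)
  have hmem : ∀ y, y ∈ Subgroup.centralizer {x} ↔ Commute x y := fun y ↦ by
    rw [Subgroup.mem_centralizer_singleton_iff]; exact ⟨fun h ↦ h.symm, fun h ↦ h.symm⟩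
  have heq := hmax (Subgroup.centralizer {x})
    (fun a ha b hb ↦ hG x hx1 a b ((hmem a).1 ha).symm ((hmem b).1 hb))
    (fun a ha ↦ (hmem a).2 (hM x hx a ha))
  exact hg (heq ▸ (hmem g).2 hcx.symm)

end CommutativeTransitive

section ProjectiveSpecialLinear

open Matrix

theorem SL2_mul_self_eq_neg_one {A X : SpecialLinearGroup (Fin 2) ℝ} (h : A * X = -(X * A)) :
    A * A = -1 := by
  have hdA := A.det_coe
  have hdX := X.det_coe
  rw [det_fin_two] at hdA hdX
  have h' : ∀ i j, ((A : Matrix (Fin 2) (Fin 2) ℝ) * X) i j = -((X : Matrix (Fin 2) (Fin 2) ℝ) * A) i j := by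
    intro i j
    have := congrArg (fun Y : SpecialLinearGroup (Fin 2) ℝ ↦ (Y : Matrix (Fin 2) (Fin 2) ℝ) i j) h
    simpa using this
  have h00 := h' 0 0
  have h01 := h' 0 1
  have h10 := h' 1 0
  have h11 := h' 1 1
  simp only [mul_apply, Fin.sum_univ_two] at h00 h01 h10 h11
  have htr : A 0 0 + A 1 1 = 0 := by
    linear_combination (1 / 2) * (X 1 1 * h00 - X 1 0 * h01 - X 0 1 * h10 + X 0 0 * h11)
      - (A 0 0 + A 1 1) * hdX
  ext i j
  fin_cases i <;> fin_cases j <;>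
    simp [mul_apply, Fin.sum_univ_two]
  · linear_combination A 0 0 * htr - hdA
  · linear_combination A 0 1 * htr
  · linear_combination A 1 0 * htr
  · linear_combination A 1 1 * htr - hdA

theorem SL2_eq_one_or_eq_neg_one_of_mem_center {Z : SpecialLinearGroup (Fin 2) ℝ}
    (hZ : Z ∈ Subgroup.center (SpecialLinearGroup (Fin 2) ℝ)) : Z = 1 ∨ Z = -1 := by
  obtain ⟨r, hr, hrZ⟩ := Matrix.SpecialLinearGroup.mem_center_iff.1 hZ
  rw [Fintype.card_fin, sq_eq_one_iff] at hr
  rcases hr with rfl | rfl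
  · left; ext i j; simp [← hrZ]
  · right; ext i j; fin_cases i <;> fin_cases j <;> simp [← hrZ]

theorem SL2_commute_of_commute {A X B : SpecialLinearGroup (Fin 2) ℝ}
    (hX : X ∉ Subgroup.center (SpecialLinearGroup (Fin 2) ℝ)) (hA : Commute A X)
    (hB : Commute X B) : Commute A B := by
  have hdX := X.det_coe
  rw [det_fin_two] at hdX
  have entries : ∀ {Y Z : SpecialLinearGroup (Fin 2) ℝ}, Commute Y Z →
      Y 0 1 * Z 1 0 = Z 0 1 * Y 1 0 ∧ (Y 0 0 - Y 1 1) * Z 0 1 = (Z 0 0 - Z 1 1) * Y 0 1 ∧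
      (Y 0 0 - Y 1 1) * Z 1 0 = (Z 0 0 - Z 1 1) * Y 1 0 := by
    intro Y Z h
    have h' : ∀ i j, ((Y : Matrix (Fin 2) (Fin 2) ℝ) * Z) i j = ((Z : Matrix (Fin 2) (Fin 2) ℝ) * Y) i j := by
      intro i j
      have := congrArg
        (fun W : SpecialLinearGroup (Fin 2) ℝ ↦ (W : Matrix (Fin 2) (Fin 2) ℝ) i j) h.eq
      simpa using this
    have h00 := h' 0 0
    have h01 := h' 0 1
    have h10 := h' 1 0
    simp only [mul_apply, Fin.sum_univ_two] at h00 h01 h10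
    exact ⟨by linear_combination h00, by linear_combination h01, by linear_combination -h10⟩
  obtain ⟨a1, a2, a3⟩ := entries hA
  obtain ⟨b1, b2, b3⟩ := entries hB
  have hne : X 0 1 ≠ 0 ∨ X 1 0 ≠ 0 ∨ X 0 0 - X 1 1 ≠ 0 := by
    by_contra! h
    obtain ⟨h1, h2, h3⟩ := h
    refine hX (Matrix.SpecialLinearGroup.mem_center_iff.2 ⟨X 0 0, ?_, ?_⟩)
    · rw [Fintype.card_fin]; linear_combination hdX + X 0 0 * h3 + X 0 1 * h2
    · ext i j
      fin_cases i <;> fin_cases j <;> simp [h1, h2]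
      linarith
  have key : A 0 1 * B 1 0 = B 0 1 * A 1 0 ∧ (A 0 0 - A 1 1) * B 0 1 = (B 0 0 - B 1 1) * A 0 1 ∧
      (A 0 0 - A 1 1) * B 1 0 = (B 0 0 - B 1 1) * A 1 0 := by
    rcases hne with h | h | h <;> refine ⟨?_, ?_, ?_⟩ <;> apply mul_left_cancel₀ h <;> grind
  obtain ⟨k1, k2, k3⟩ := key
  rw [commute_iff_eq]
  ext i j
  fin_cases i <;> fin_cases j <;> simp [mul_apply, Fin.sum_univ_two]
  · linear_combination k1
  · linear_combination k2
  · linear_combination -k3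
  · linear_combination -k1

/-- A group without involutions embedding into `PSL(2, ℝ)` is commutative transitive. -/
theorem isCommTransitive_of_injective_PSL2 {G : Type*} [Group G] {ρ : G →* PSL(2, ℝ)}
    (hρ : Function.Injective ρ) (h2 : ∀ x : G, x * x = 1 → x = 1) : IsCommTransitive G := by
  have key : ∀ {a x : G} {A X : SpecialLinearGroup (Fin 2) ℝ}, (A : PSL(2, ℝ)) = ρ a →
      (X : PSL(2, ℝ)) = ρ x → Commute a x → Commute A X := by
    intro a x A X hA hX h
    have hc : (X * A)⁻¹ * (A * X) ∈ Subgroup.center (SpecialLinearGroup (Fin 2) ℝ) := by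
      rw [← QuotientGroup.eq, QuotientGroup.mk_mul, QuotientGroup.mk_mul, hA, hX, ← map_mul,
        ← map_mul, h.eq]
    rcases SL2_eq_one_or_eq_neg_one_of_mem_center hc with h1 | h1
    · exact (inv_mul_eq_one.1 h1).symm
    · have hneg : A * X = -(X * A) := by
        rw [inv_mul_eq_iff_eq_mul] at h1
        simpa using h1
      have hA2 := SL2_mul_self_eq_neg_one hneg
      have ha : a = 1 := by
        refine h2 a (hρ ?_)
        rw [map_mul, ← hA, ← QuotientGroup.mk_mul, hA2, map_one, QuotientGroup.eq_one_iff,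
          Subgroup.mem_center_iff]
        intro g; simp
      rw [ha, map_one, QuotientGroup.eq_one_iff, Subgroup.mem_center_iff] at hA
      exact (hA X).symm
  intro x hx a b hax hxb
  obtain ⟨A, hA⟩ := QuotientGroup.mk_surjective (ρ a)
  obtain ⟨B, hB⟩ := QuotientGroup.mk_surjective (ρ b)
  obtain ⟨X, hX⟩ := QuotientGroup.mk_surjective (ρ x)
  have hXc : X ∉ Subgroup.center (SpecialLinearGroup (Fin 2) ℝ) := by
    rw [← QuotientGroup.eq_one_iff, hX, ← map_one ρ, hρ.eq_iff]
    exact hx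
  have hAB := SL2_commute_of_commute hXc (key hA hX hax) (key hX hB hxb)
  apply hρ
  rw [map_mul, map_mul, ← hA, ← hB, ← QuotientGroup.mk_mul, ← QuotientGroup.mk_mul, hAB.eq]

end ProjectiveSpecialLinear

section Pushout

open Monoid

variable {G ι B : Type*} {Gf : ι → Type*} [Group G] [Group B] [∀ i, Group (Gf i)]
  {φ : ∀ i, B →* Gf i}

theorem AltForm.exists_word {K : ι → Subgroup G} {H : Subgroup G} {f : G →* PushoutI φ}
    (hK : ∀ i, ∀ s ∈ K i, ∃ t : Gf i, f s = PushoutI.of i t ∧ (t ∈ (φ i).range → s ∈ H))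
    {n : ℕ} {i : Option ι} {g : G} (hg : AltForm K H n i g) :
    ∃ w : CoprodI.Word Gf, PushoutI.Reduced φ w ∧ w.fstIdx = i ∧ w.toList.length = n ∧
      ∃ h ∈ H, f g = PushoutI.ofCoprodI w.prod * f h := by
  induction hg with
  | @base h hh =>
    exact ⟨.empty, by simp [PushoutI.Reduced, CoprodI.Word.empty],
      by simp [CoprodI.Word.fstIdx, CoprodI.Word.empty], by simp [CoprodI.Word.empty], h, hh,
      by simp⟩
  | @cons n j i s g hs hsH hg hj ih =>
    obtain ⟨w, hw, hwj, hwn, h, hh, hwg⟩ := ih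
    obtain ⟨t, hst, ht⟩ := hK i s hs
    have htr : t ∉ (φ i).range := fun h ↦ hsH (ht h)
    have ht1 : t ≠ 1 := by rintro rfl; exact htr (one_mem _)
    refine ⟨w.cons t (hwj ▸ hj) ht1, ?_, CoprodI.Word.fstIdx_cons .., ?_, h, hh, ?_⟩
    · intro x hx
      rcases List.mem_cons.1 hx with rfl | hx
      · exact htr
      · exact hw x hx
    · simp [CoprodI.Word.cons, hwn]
    · rw [map_mul, hwg, hst, CoprodI.Word.prod_cons, map_mul, PushoutI.ofCoprodI_of, mul_assoc]

/-- A homomorphism to a pushout of groups along injective maps certifies that a generating family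
of subgroups exhibits a group as an amalgamated product. -/
theorem IsAmalgam_s18.of_pushoutI {K : ι → Subgroup G} {H : Subgroup G}
    (hφ : ∀ i, Function.Injective (φ i)) (f : G →* PushoutI φ) (hle : ∀ i, H ≤ K i)
    (hcl : Subgroup.closure (⋃ i, (K i : Set G)) = ⊤)
    (hK : ∀ i, ∀ s ∈ K i, ∃ t : Gf i, f s = PushoutI.of i t ∧ (t ∈ (φ i).range → s ∈ H))
    (hH : ∀ h ∈ H, f h ∈ (PushoutI.base φ).range) : IsAmalgam_s18 K H where
  le := hle
  closure_eq := hcl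
  eq_zero n i g hg hgH := by
    obtain ⟨w, hw, -, hwn, h, hh, hwg⟩ := hg.exists_word hK
    have := hw.eq_empty_of_mem_range hφ (by
      rw [← mul_inv_eq_iff_eq_mul.2 hwg]
      exact mul_mem (hH g hgH) (inv_mem (hH h hh)))
    rw [← hwn, this]
    rfl

end Pushout

section Presentation

open Monoid

variable {α : Type*}

/-- The relators `a i ^ e i` presenting a free product of cyclic groups. -/
def powerRels (e : α → ℕ) : Set (FreeGroup α) :=
  {w | ∃ i, w = FreeGroup.of i ^ e i}

theorem PresentedGroup.of_pow_eq_one {e : α → ℕ} {R : Set (FreeGroup α)} (hR : powerRels e ⊆ R)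
    (i : α) : (PresentedGroup.of i : PresentedGroup R) ^ e i = 1 :=
  PresentedGroup.one_of_mem (hR ⟨i, rfl⟩)

theorem closure_iUnion_eq_top_of_of_mem {R : Set (FreeGroup α)} {ι : Type*}
    {K : ι → Subgroup (PresentedGroup R)} (hK : ∀ a, ∃ i, PresentedGroup.of a ∈ K i) :
    Subgroup.closure (⋃ i, (K i : Set (PresentedGroup R))) = ⊤ := by
  rw [eq_top_iff, ← PresentedGroup.closure_range_of, Subgroup.closure_le]
  rintro _ ⟨a, rfl⟩
  obtain ⟨i, hi⟩ := hK a
  exact Subgroup.subset_closure (Set.mem_iUnion.2 ⟨i, hi⟩)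

theorem isAmalgam_powerRels (e : α → ℕ) :
    IsAmalgam_s18 (fun i ↦ Subgroup.zpowers (PresentedGroup.of i : PresentedGroup (powerRels e)))
      ⊥ := by
  let φ : ∀ i : α, Unit →* Multiplicative (ZMod (e i)) := fun _ ↦ 1
  let a : ∀ i : α, Multiplicative (ZMod (e i)) := fun _ ↦ Multiplicative.ofAdd 1
  have ha : ∀ i (k : ℤ), a i ^ k = Multiplicative.ofAdd (k : ZMod (e i)) := fun i k ↦ by
    rw [← ofAdd_zsmul, zsmul_one]
  let f : PresentedGroup (powerRels e) →* PushoutI φ :=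
    PresentedGroup.toGroup (f := fun i ↦ PushoutI.of i (a i)) (by
      rintro _ ⟨i, rfl⟩
      have := ha i (e i)
      rw [zpow_natCast] at this
      rw [map_pow, FreeGroup.lift_apply_of, ← map_pow, this]
      simp)
  refine IsAmalgam_s18.of_pushoutI (fun i _ _ _ ↦ rfl) f (fun _ ↦ bot_le)
    (closure_iUnion_eq_top_of_of_mem fun i ↦ ⟨i, Subgroup.mem_zpowers _⟩) ?_ ?_
  · rintro i _ ⟨k, rfl⟩
    refine ⟨a i ^ k, by simp [f], ?_⟩
    rintro ⟨x, hx⟩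
    have hk : (k : ZMod (e i)) = 0 := by
      rw [ha] at hx
      exact hx.symm
    obtain ⟨m, rfl⟩ := (ZMod.intCast_zmod_eq_zero_iff_dvd k (e i)).1 hk
    simp [zpow_mul, PresentedGroup.of_pow_eq_one subset_rfl]
  · rintro h rfl
    exact (map_one f).symm ▸ one_mem _

theorem zpowersHom_injective {H : Type*} [Group H] {x : H} (hx : ¬ IsOfFinOrder x) :
    Function.Injective (zpowersHom H x) := fun _ _ h ↦
  Multiplicative.toAdd.injective (injective_zpow_iff_not_isOfFinOrder.2 hx h)

/-- The exponents `e` on one side of a bipartition `s` of the generators; the generators of the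
other side are killed. -/
def sideExponent (e : α → ℕ) (s : α → Bool) (b : Bool) (i : α) : ℕ :=
  if s i = b then e i else 1

/-- The free group on the generators on one side of a bipartition. -/
def sideSubgroup (s : α → Bool) (b : Bool) : Subgroup (FreeGroup α) :=
  Subgroup.closure {w | ∃ i, s i = b ∧ w = FreeGroup.of i}

theorem MonoidHom.eq_of_mem_sideSubgroup {s : α → Bool} {b : Bool} {H : Type*} [Group H]
    {f g : FreeGroup α →* H} (h : ∀ i, s i = b → f (FreeGroup.of i) = g (FreeGroup.of i))
    {w : FreeGroup α} (hw : w ∈ sideSubgroup s b) : f w = g w := by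
  refine MonoidHom.eqOn_closure ?_ hw
  rintro _ ⟨i, hi, rfl⟩
  exact h i hi

theorem mem_sideSubgroup {s : α → Bool} {b : Bool} [DecidableEq α] {w : FreeGroup α}
    (hw : ∀ x ∈ w.toWord, s x.1 = b) : w ∈ sideSubgroup s b := by
  rw [← FreeGroup.mk_toWord (x := w)]
  generalize w.toWord = L at hw
  induction L with
  | nil => exact one_mem _
  | cons x L ih =>
    have hx : FreeGroup.of x.1 ∈ sideSubgroup s b :=
      Subgroup.subset_closure ⟨x.1, hw x List.mem_cons_self, rfl⟩
    have hL := ih fun y hy ↦ hw y (List.mem_cons_of_mem _ hy)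
    obtain ⟨a, _ | _⟩ := x
    · exact mul_mem (inv_mem hx) hL
    · exact mul_mem hx hL

variable {e : α → ℕ} {s : α → Bool} {W : Bool → FreeGroup α} {R : Set (FreeGroup α)}

/-- The map from the free product of cyclic groups on one side of a bipartition of the
generators to a group in which all the power relations hold. -/
def sideMap (hR : powerRels e ⊆ R) (s : α → Bool) (b : Bool) :
    PresentedGroup (powerRels (sideExponent e s b)) →* PresentedGroup R :=
  PresentedGroup.toGroup (f := fun i ↦ if s i = b then PresentedGroup.of i else 1) (by
    rintro _ ⟨i, rfl⟩
    by_cases hi : s i = b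
    · simp [hi, sideExponent, PresentedGroup.of_pow_eq_one hR]
    · simp [hi])

theorem sideMap_of (hR : powerRels e ⊆ R) {b : Bool} {i : α} (hi : s i = b) :
    sideMap hR s b (PresentedGroup.of i) = PresentedGroup.of i := by
  simp [sideMap, hi]

theorem sideMap_mk (hR : powerRels e ⊆ R) {b : Bool} {w : FreeGroup α}
    (hw : w ∈ sideSubgroup s b) :
    sideMap hR s b (PresentedGroup.mk _ w) = PresentedGroup.mk R w :=
  MonoidHom.eq_of_mem_sideSubgroup
    (f := (sideMap hR s b).comp (PresentedGroup.mk _)) (fun _ hi ↦ sideMap_of hR hi) hw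

theorem exists_hom_pushoutI (hR : R = powerRels e ∪ {W true * (W false)⁻¹})
    (hW : ∀ b, W b ∈ sideSubgroup s b) :
    ∃ f : PresentedGroup R →* PushoutI fun b ↦
      zpowersHom (PresentedGroup (powerRels (sideExponent e s b))) (PresentedGroup.mk _ (W b)),
    ∀ b x, f (sideMap (hR ▸ Set.subset_union_left) s b x) = PushoutI.of b x := by
  let φ := fun b ↦
    zpowersHom (PresentedGroup (powerRels (sideExponent e s b))) (PresentedGroup.mk _ (W b))
  have hlift : ∀ b, FreeGroup.lift (fun i ↦ PushoutI.of (φ := φ) (s i) (PresentedGroup.of i))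
      (W b) = PushoutI.base φ (Multiplicative.ofAdd 1) := by
    intro b
    rw [← PushoutI.of_apply_eq_base φ b]
    refine (MonoidHom.eq_of_mem_sideSubgroup
      (g := (PushoutI.of (φ := φ) b).comp (PresentedGroup.mk _)) ?_ (hW b)).trans ?_
    · rintro i rfl
      simp [PresentedGroup.of]
    · simp [φ]
  let f : PresentedGroup R →* PushoutI φ :=
    PresentedGroup.toGroup (f := fun i ↦ PushoutI.of (φ := φ) (s i) (PresentedGroup.of i)) (by
      rw [hR]
      rintro _ (⟨i, rfl⟩ | rfl)
      · have := PresentedGroup.of_pow_eq_one (e := sideExponent e s (s i)) subset_rfl i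
        rw [sideExponent, if_pos rfl] at this
        rw [map_pow, FreeGroup.lift_apply_of, ← map_pow, this, map_one]
      · rw [map_mul, map_inv, hlift, hlift, mul_inv_cancel])
  refine ⟨f, fun b x ↦ ?_⟩
  change (f.comp _) x = _
  congr 1
  ext i
  by_cases hi : s i = b
  · subst hi
    simp [sideMap_of, f]
  · have := PresentedGroup.of_pow_eq_one (e := sideExponent e s b) subset_rfl i
    rw [sideExponent, if_neg hi, pow_one] at this
    simp [this]

theorem sideMap_injective (hR : R = powerRels e ∪ {W true * (W false)⁻¹})
    (hW : ∀ b, W b ∈ sideSubgroup s b)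
    (hord : ∀ b, ¬ IsOfFinOrder
      (PresentedGroup.mk (powerRels (sideExponent e s b)) (W b))) (b : Bool) :
    Function.Injective (sideMap (R := R) (hR ▸ Set.subset_union_left) s b) := by
  obtain ⟨f, hf⟩ := exists_hom_pushoutI hR hW
  refine Function.Injective.of_comp (f := f) ?_
  convert PushoutI.of_injective (fun b ↦ zpowersHom_injective (hord b)) b
  exact funext (hf b)

theorem isAmalgam_sideMap (hR : R = powerRels e ∪ {W true * (W false)⁻¹})
    (hW : ∀ b, W b ∈ sideSubgroup s b)
    (hord : ∀ b, ¬ IsOfFinOrder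
      (PresentedGroup.mk (powerRels (sideExponent e s b)) (W b))) :
    IsAmalgam_s18 (fun b ↦ (sideMap (R := R) (hR ▸ Set.subset_union_left) s b).range)
      (Subgroup.zpowers (PresentedGroup.mk R (W true))) := by
  have hR' : powerRels e ⊆ R := hR ▸ Set.subset_union_left
  obtain ⟨f, hf⟩ := exists_hom_pushoutI hR hW
  have hu : ∀ b, sideMap hR' s b (PresentedGroup.mk _ (W b)) = PresentedGroup.mk R (W true) := by
    intro b
    rw [sideMap_mk hR' (hW b)]
    cases b
    · have : PresentedGroup.mk R (W true * (W false)⁻¹) = 1 :=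
        PresentedGroup.one_of_mem (by simp [hR])
      rw [map_mul, map_inv, mul_inv_eq_one] at this
      exact this.symm
    · rfl
  refine IsAmalgam_s18.of_pushoutI (fun b ↦ zpowersHom_injective (hord b)) f (fun b ↦ ?_)
    (closure_iUnion_eq_top_of_of_mem fun i ↦ ⟨s i, _, sideMap_of hR' rfl⟩) ?_ ?_
  · rw [Subgroup.zpowers_le]
    exact ⟨_, hu b⟩
  · rintro b _ ⟨x, rfl⟩
    refine ⟨x, hf b x, ?_⟩
    rintro ⟨k, rfl⟩
    rw [zpowersHom_apply, map_zpow, hu]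
    exact Subgroup.zpow_mem_zpowers _ _
  · rintro _ ⟨k, rfl⟩
    rw [map_zpow]
    refine zpow_mem ?_ k
    rw [← hu true, hf]
    refine ⟨Multiplicative.ofAdd 1, ?_⟩
    rw [← PushoutI.of_apply_eq_base _ true]
    simp

theorem IsCommTransitive.commutesOfCommuteConj_presentedGroup [Nonempty α]
    (hR : R = powerRels e ∪ {W true * (W false)⁻¹}) (hW : ∀ b, W b ∈ sideSubgroup s b)
    (hord : ∀ b, ¬ IsOfFinOrder
      (PresentedGroup.mk (powerRels (sideExponent e s b)) (W b)))
    (hG : IsCommTransitive (PresentedGroup R)) (h2 : ∀ x : PresentedGroup R, x * x = 1 → x = 1) :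
    CommutesOfCommuteConj (PresentedGroup R) := by
  have hinj := sideMap_injective hR hW hord
  refine hG.commutesOfCommuteConj_of_zpowers (isAmalgam_sideMap hR hW hord) h2 ?_ ?_
  · intro h
    have hW1 := sideMap_mk (R := R) (hR ▸ Set.subset_union_left) (hW true)
    rw [h, map_eq_one_iff _ (hinj true)] at hW1
    exact hord true (hW1 ▸ IsOfFinOrder.one)
  · rintro b _ ⟨x, rfl⟩ _ ⟨g, rfl⟩ hx
    rw [← map_mul, ← map_inv, ← map_mul, commute_map_iff (hinj b)] at hx
    rw [commute_map_iff (hinj b)]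
    refine (hG.of_injective (hinj b)).commutesOfCommuteConj_of_bot (isAmalgam_powerRels _) ?_ ?_
      x g hx
    · intro y hy
      refine hinj b ((h2 _ ?_).trans (map_one _).symm)
      rw [← map_mul, hy, map_one]
    · rintro i _ ⟨k, rfl⟩ _ ⟨l, rfl⟩
      exact (Commute.refl _).zpow_zpow _ _

end Presentation

theorem eq_one_of_mul_self_eq_one {G : Type*} [Group G]
    (h : ∀ g : G, IsOfFinOrder g → Odd (orderOf g)) {x : G} (hx : x * x = 1) : x = 1 := by
  rw [← pow_two] at hx
  have hodd := h x (isOfFinOrder_iff_pow_eq_one.2 ⟨2, two_pos, hx⟩)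
  rcases (Nat.dvd_prime Nat.prime_two).1 (orderOf_dvd_of_pow_eq_one hx) with h1 | h1
  · exact orderOf_eq_one_iff.1 h1
  · rw [h1] at hodd
    exact absurd hodd (by decide)

namespace FTypeBase

theorem commutesOfCommuteConj (D : FTypeBase) (hD : D.IsFType) (hG : IsCommTransitive D.Gp)
    (h2 : ∀ x : D.Gp, x * x = 1 → x = 1) : CommutesOfCommuteConj D.Gp := by
  obtain ⟨hn, -, -, -, hU, hV, -, -, hU1, hV2, -, -⟩ := hD
  let s : Fin D.n → Bool := fun i ↦ decide ((i : ℕ) < D.p)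
  let W : Bool → FreeGroup (Fin D.n) := fun b ↦ bif b then D.U else D.V⁻¹
  have : Nonempty (Fin D.n) := ⟨⟨0, by omega⟩⟩
  have h1 : D.rels1 = powerRels (sideExponent D.e s true) := by
    ext w
    simp only [rels1, powerRels, sideExponent, s, Set.mem_union, Set.mem_ofPred_eq,
      decide_eq_true_eq, ← exists_or]
    refine exists_congr fun i ↦ ?_
    by_cases hi : (i : ℕ) < D.p
    · simp [hi]
    · simp [hi, not_lt.1 hi]
  have h2' : D.rels2 = powerRels (sideExponent D.e s false) := by
    ext w
    simp only [rels2, powerRels, sideExponent, s, Set.mem_union, Set.mem_ofPred_eq,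
      decide_eq_false_iff_not, ← exists_or]
    refine exists_congr fun i ↦ ?_
    by_cases hi : (i : ℕ) < D.p
    · simp [hi]
    · simp [hi, not_lt.1 hi]
  refine hG.commutesOfCommuteConj_presentedGroup (e := D.e) (s := s) (W := W) ?_ ?_ ?_ h2
  · simp [rels, powerRels, W]
  · rintro (_ | _)
    · exact inv_mem (mem_sideSubgroup fun x hx ↦ by simpa [s] using hV x hx)
    · exact mem_sideSubgroup fun x hx ↦ by simpa [s] using hU x hx
  · rintro (_ | _)
    · rw [← h2']
      simpa [W, imgV2] using hV2
    · rw [← h1]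
      exact hU1

end FTypeBase

/-- A group of F-type with a faithful representation into `PSL(2, ℝ)` which is
torsion-free or has only odd torsion is CSA: every maximal abelian subgroup is malnormal. -/
theorem fType_csa (D : FTypeBase) (hD : D.IsFType)
    (hfaith : ∃ ρ : D.Gp →* PSL(2, ℝ), Function.Injective ρ)
    (htors : ∀ g : D.Gp, IsOfFinOrder g → Odd (orderOf g)) :
    ∀ M : Subgroup D.Gp, (∀ x ∈ M, ∀ y ∈ M, x * y = y * x) →
      (∀ M' : Subgroup D.Gp, (∀ x ∈ M', ∀ y ∈ M', x * y = y * x) → M ≤ M' → M' = M) →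
      IsMalnormal M := by
  obtain ⟨ρ, hρ⟩ := hfaith
  have h2 : ∀ x : D.Gp, x * x = 1 → x = 1 := fun x ↦ eq_one_of_mul_self_eq_one htors
  have hG := isCommTransitive_of_injective_PSL2 hρ h2
  exact fun M hM hmax ↦ hG.isMalnormal (D.commutesOfCommuteConj hD hG h2) hM hmax

end FPaper
end

section
/- Freiheitssatz for one-relator amalgamated products: Let G = G_1 *_A G_2 be an amalgamated free product with A = ⟨a⟩ cyclic, and let R ∈ G ∖ A be given in reduced form R = c_1 d_1 ⋯ c_k d_k with k ≥ 1, c_i ∈ G_1 ∖ A and d_i ∈ G_2 ∖ A for i = 1,…,k. Assume there is a representation φ: G → PSL(2,ℂ) such that the restrictions of φ to G_1 and G_2 are faithful and, for each i, the pairs {φ(c_i), φ(a)} and {φ(d_i), φ(a)} are irreducible. Then for every m ≥ 2 the quotient H = G/N(R^m) of G by the normal closure of R^m admits a representation ρ: H → PSL(2,ℂ) such that the compositions G_1 → H → PSL(2,ℂ) and G_2 → H → PSL(2,ℂ) are faithful and ρ(R) has order exactly m; in particular, the natural homomorphisms G_1 → H and G_2 → H are injective. -/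
open scoped MatrixGroups

namespace FPaper

/-- `G` is the (internal) amalgamated free product of its subgroups `G₁` and `G₂` over
`A = G₁ ⊓ G₂`: the two factors generate `G` and no non-empty alternating product of elements of
`G₁ ∖ A` and `G₂ ∖ A` is trivial. -/
def IsAmalgam (G : Type*) [Group G] (G₁ G₂ A : Subgroup G) : Prop :=
  A = G₁ ⊓ G₂ ∧ G₁ ⊔ G₂ = ⊤ ∧
    ∀ (k t : ℕ) (w : Fin k → G), 1 ≤ k →
      (∀ i : Fin k, ((i : ℕ) + t) % 2 = 0 → w i ∈ G₁ ∧ w i ∉ A) →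
      (∀ i : Fin k, ((i : ℕ) + t) % 2 = 1 → w i ∈ G₂ ∧ w i ∉ A) →
      (List.ofFn w).prod ≠ 1

/-- A pair of elements of `PSL(2, ℂ)` is *irreducible* if, regarded as linear fractional
transformations, they have no common fixed point, i.e. the trace of their commutator (which is
well defined independently of the choice of lifts to `SL(2, ℂ)`) is not `2`. -/
def IrreduciblePair (x y : PSL(2, ℂ)) : Prop :=
  ∀ x' y' : SL(2, ℂ), (QuotientGroup.mk x' : PSL(2, ℂ)) = x →
    (QuotientGroup.mk y' : PSL(2, ℂ)) = y →
    Matrix.trace ((x' * y' * x'⁻¹ * y'⁻¹ : SL(2, ℂ)) : Matrix (Fin 2) (Fin 2) ℂ) ≠ 2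

/-- `AlternatingProduct K b x` says that `x` is a non-empty product of elements taken alternately
from `K true` and `K false`, none of them in both, the first one from `K b`. -/
inductive AlternatingProduct {H : Type*} [Group H] (K : Bool → Subgroup H) : Bool → H → Prop
  | single {b : Bool} {x : H} (hx : x ∈ K b) (hx' : x ∉ K (!b)) : AlternatingProduct K b x
  | cons {b : Bool} {x y : H} (hx : x ∈ K b) (hx' : x ∉ K (!b))
      (hy : AlternatingProduct K (!b) y) : AlternatingProduct K b (x * y)

namespace AlternatingProduct

variable {H H' : Type*} [Group H] [Group H'] {K : Bool → Subgroup H}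

theorem mul_left {b : Bool} {g x : H} (hg : ∀ b, g ∈ K b) (h : AlternatingProduct K b x) :
    AlternatingProduct K b (g * x) := by
  cases h with
  | single hx hx' =>
    exact single (mul_mem (hg _) hx) fun h => hx' ((Subgroup.mul_mem_cancel_left _ (hg _)).1 h)
  | cons hx hx' hy =>
    rw [← mul_assoc]
    exact cons (mul_mem (hg _) hx)
      (fun h => hx' ((Subgroup.mul_mem_cancel_left _ (hg _)).1 h)) hy

theorem mul_mem_or {b b' : Bool} {g x : H} (hg : g ∈ K b') (h : AlternatingProduct K b x) :
    (∀ b, g * x ∈ K b) ∨ ∃ b, AlternatingProduct K b (g * x) := by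
  have key {x : H} (b : Bool) (h : x ∈ K b) (h' : x ∈ K (!b)) (b' : Bool) : x ∈ K b' := by
    cases b <;> cases b' <;> assumption
  by_cases hg' : g ∈ K (!b')
  · exact .inr ⟨b, h.mul_left (key b' hg hg')⟩
  obtain rfl | rfl : b = b' ∨ b = !b' := by cases b <;> cases b' <;> simp
  · cases h with
    | @single _ x hx hx' =>
      by_cases hgx : g * x ∈ K (!b)
      · exact .inl (key b (mul_mem hg hx) hgx)
      · exact .inr ⟨b, single (mul_mem hg hx) hgx⟩
    | @cons _ x y hx hx' hy =>
      rw [← mul_assoc]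
      by_cases hgx : g * x ∈ K (!b)
      · exact .inr ⟨!b, hy.mul_left (key b (mul_mem hg hx) hgx)⟩
      · exact .inr ⟨b, cons (mul_mem hg hx) hgx hy⟩
  · exact .inr ⟨b', cons hg hg' h⟩

theorem forall_mem_or_of_mem_iSup {x : H} (hx : x ∈ ⨆ b, K b) :
    (∀ b, x ∈ K b) ∨ ∃ b, AlternatingProduct K b x := by
  have step {b : Bool} {g x : H} (hg : g ∈ K b)
      (h : (∀ b, x ∈ K b) ∨ ∃ b, AlternatingProduct K b x) :
      (∀ b, g * x ∈ K b) ∨ ∃ b, AlternatingProduct K b (g * x) := by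
    rcases h with h | ⟨b', h⟩
    · by_cases hg' : g ∈ K (!b)
      · left
        intro b'
        refine mul_mem ?_ (h b')
        cases b <;> cases b' <;> assumption
      · exact .inr ⟨b, single (mul_mem hg (h b))
          fun h' => hg' ((Subgroup.mul_mem_cancel_right _ (h _)).1 h')⟩
    · exact h.mul_mem_or hg
  rw [Subgroup.iSup_eq_closure] at hx
  induction hx using Subgroup.closure_induction_left with
  | one => exact .inl fun b => one_mem _
  | mul_left g hg y _ ih =>
    obtain ⟨b, hb⟩ := Set.mem_iUnion.1 hg
    exact step hb ih
  | inv_mul_cancel g hg y _ ih =>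
    obtain ⟨b, hb⟩ := Set.mem_iUnion.1 hg
    exact step (inv_mem hb) ih

theorem map {L : Bool → Subgroup H'} (f : H →* H')
    (hf : ∀ b, ∀ x ∈ K b, f x ∈ L b ∧ (x ∉ K (!b) → f x ∉ L (!b))) {b : Bool} {x : H}
    (h : AlternatingProduct K b x) : AlternatingProduct L b (f x) := by
  induction h with
  | single hx hx' => exact single (hf _ _ hx).1 ((hf _ _ hx).2 hx')
  | cons hx hx' _ ih =>
    rw [map_mul]
    exact cons (hf _ _ hx).1 ((hf _ _ hx).2 hx') ih

theorem exists_ofFn_prod_eq {b : Bool} {x : H} (h : AlternatingProduct K b x) :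
    ∃ (n : ℕ) (w : Fin n → H), 1 ≤ n ∧ (List.ofFn w).prod = x ∧
      ∀ i : Fin n, w i ∈ K (b ^^ Nat.bodd i) ∧ w i ∉ K (!(b ^^ Nat.bodd i)) := by
  induction h with
  | @single b x hx hx' => exact ⟨1, fun _ => x, le_rfl, by simp, fun i => by simp [hx, hx']⟩
  | @cons b x y hx hx' _ ih =>
    obtain ⟨n, w, -, hw, h⟩ := ih
    refine ⟨n + 1, Fin.cons x w, by omega, by simp [hw], fun i => ?_⟩
    refine Fin.cases (by simp [hx, hx']) (fun j => ?_) i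
    simpa using h j

end AlternatingProduct

theorem IsAmalgam.ne_one_of_alternatingProduct {G : Type*} [Group G] {G₁ G₂ A : Subgroup G}
    (hA : IsAmalgam G G₁ G₂ A) {b : Bool} {x : G}
    (h : AlternatingProduct (fun b => cond b G₁ G₂) b x) : x ≠ 1 := by
  obtain ⟨rfl, -, hne⟩ := hA
  obtain ⟨n, w, hn, rfl, hw⟩ := h.exists_ofFn_prod_eq
  refine hne n (cond b 0 1) w hn (fun i hi => ?_) (fun i hi => ?_) <;>
  · have := hw i
    rw [Nat.mod_two_of_bodd] at hi
    cases b <;> cases hb : Nat.bodd i <;> simp_all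

/-- The universal property of an amalgamated free product. -/
theorem IsAmalgam.exists_monoidHom {G P : Type*} [Group G] [Group P] {G₁ G₂ A : Subgroup G}
    (hA : IsAmalgam G G₁ G₂ A) (f₁ : G₁ →* P) (f₂ : G₂ →* P)
    (hf : ∀ (x : G) (h₁ : x ∈ G₁) (h₂ : x ∈ G₂), f₁ ⟨x, h₁⟩ = f₂ ⟨x, h₂⟩) :
    ∃ ρ : G →* P, (∀ x : G₁, ρ x = f₁ x) ∧ ∀ x : G₂, ρ x = f₂ x := by
  let K : Bool → Subgroup (G × P) := fun b =>
    cond b (G₁.subtype.prod f₁).range (G₂.subtype.prod f₂).range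
  have hK {b : Bool} {x : G × P} (hx : AlternatingProduct K b x) : x.1 ≠ 1 := by
    refine hA.ne_one_of_alternatingProduct (hx.map (MonoidHom.fst G P) ?_)
    rintro (_ | _) _ ⟨x, rfl⟩
    · exact ⟨x.2, fun h h' => h ⟨⟨x, h'⟩, Prod.ext rfl (hf _ _ _)⟩⟩
    · exact ⟨x.2, fun h h' => h ⟨⟨x, h'⟩, Prod.ext rfl (hf _ _ _).symm⟩⟩
  let π : ↥(⨆ b, K b) →* G := (MonoidHom.fst G P).comp (⨆ b, K b).subtype
  have hπ : Function.Bijective π := by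
    constructor
    · refine (injective_iff_map_eq_one π).2 fun x hx => Subtype.ext ?_
      obtain h | ⟨b, h⟩ := AlternatingProduct.forall_mem_or_of_mem_iSup x.2
      · obtain ⟨g, hg⟩ := h true
        have hg1 : g = 1 := Subtype.ext ((congrArg Prod.fst hg).trans hx)
        rw [← hg, hg1, map_one, Subgroup.coe_one]
      · exact absurd hx (hK h)
    · rw [← MonoidHom.range_eq_top, eq_top_iff, ← hA.2.1, sup_le_iff]
      exact ⟨fun g hg => ⟨⟨_, (le_iSup K true) ⟨⟨g, hg⟩, rfl⟩⟩, rfl⟩,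
        fun g hg => ⟨⟨_, (le_iSup K false) ⟨⟨g, hg⟩, rfl⟩⟩, rfl⟩⟩
  let e := MulEquiv.ofBijective π hπ
  have he (x : ↥(⨆ b, K b)) : e.symm x.1.1 = x := e.symm_apply_apply x
  refine ⟨((MonoidHom.snd G P).comp (⨆ b, K b).subtype).comp e.symm.toMonoidHom,
    fun x => ?_, fun x => ?_⟩
  · exact congrArg (fun y => y.1.2) (he ⟨_, (le_iSup K true) ⟨x, rfl⟩⟩)
  · exact congrArg (fun y => y.1.2) (he ⟨_, (le_iSup K false) ⟨x, rfl⟩⟩)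
open Polynomial in
/-- Coefficients in the top degree multiply along a product of polynomial matrices. -/
theorem map_coeff_list_prod {n : Type*} [Fintype n] [DecidableEq n] {S : Type*} [CommRing S]
    (e : ℕ) (l : List (Matrix n n S[X])) (hl : ∀ M ∈ l, ∀ i j, (M i j).natDegree ≤ e) :
    (∀ i j, (l.prod i j).natDegree ≤ e * l.length) ∧
      l.prod.map (coeff · (e * l.length)) = (l.map fun M => M.map (coeff · e)).prod := by
  induction l with
  | nil =>
    refine ⟨fun i j => ?_, ?_⟩
    · by_cases h : i = j <;> simp [h]
    · ext i j
      by_cases h : i = j <;> simp [h]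
  | cons M l ih =>
    obtain ⟨hdeg, hcoeff⟩ := ih fun N hN => hl N (List.mem_cons_of_mem _ hN)
    have hM := hl M List.mem_cons_self
    have hlen : e * (M :: l).length = e + e * l.length := by simp; ring
    rw [hlen, List.prod_cons, List.map_cons, List.prod_cons, ← hcoeff]
    refine ⟨fun i j => ?_, ?_⟩
    · rw [Matrix.mul_apply]
      exact natDegree_sum_le_of_forall_le _ _ fun x _ => natDegree_mul_le_of_le (hM _ _) (hdeg _ _)
    · ext i j
      simp only [Matrix.map_apply, Matrix.mul_apply, finsetSum_coeff]
      exact Finset.sum_congr rfl fun x _ => coeff_mul_add_eq_of_natDegree_le (hM _ _) (hdeg _ _)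

/-- The matrix `M` vanishes outside column `j`, and its `j`-th diagonal entry is non-zero. -/
def ConcentratedInColumn {n F : Type*} [Zero F] (j : n) (M : Matrix n n F) : Prop :=
  (∀ i j', j' ≠ j → M i j' = 0) ∧ M j j ≠ 0

namespace ConcentratedInColumn

variable {n F : Type*} [Fintype n] [Field F] {j : n}

theorem mul {M N : Matrix n n F} (hM : ConcentratedInColumn j M)
    (hN : ConcentratedInColumn j N) : ConcentratedInColumn j (M * N) := by
  refine ⟨fun i j' hj => ?_, ?_⟩
  · simp [Matrix.mul_apply, hN.1 _ _ hj]
  · rw [Matrix.mul_apply, Fintype.sum_eq_single j (fun x hx => by simp [hM.1 _ _ hx])]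
    exact mul_ne_zero hM.2 hN.2

theorem list_prod [DecidableEq n] {l : List (Matrix n n F)} (hl : l ≠ [])
    (h : ∀ M ∈ l, ConcentratedInColumn j M) : ConcentratedInColumn j l.prod := by
  induction l with
  | nil => exact absurd rfl hl
  | cons M l ih =>
    by_cases hl' : l = []
    · simpa [hl'] using h
    · rw [List.prod_cons]
      exact (h M List.mem_cons_self).mul (ih hl' fun N hN => h N (List.mem_cons_of_mem _ hN))

theorem trace_ne_zero {M : Matrix n n F} (hM : ConcentratedInColumn j M) : M.trace ≠ 0 := by
  rw [Matrix.trace, Fintype.sum_eq_single j (fun x hx => by simp [hM.1 _ _ hx])]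
  exact hM.2

end ConcentratedInColumn

open Polynomial in
/-- If the top coefficients of a non-empty list of polynomial matrices are concentrated in one
column, then the trace of the product is a non-constant polynomial, which takes all values. -/
theorem exists_trace_list_prod_eq {n F : Type*} [Fintype n] [DecidableEq n] [Field F]
    [IsAlgClosed F] (j : n) (e : ℕ) (l : List (Matrix n n F[X])) (hl : l ≠ [])
    (hdeg : ∀ M ∈ l, ∀ i j, (M i j).natDegree ≤ e)
    (hcol : ∀ M ∈ l, ConcentratedInColumn j (M.map (coeff · e))) (p : F[X])
    (hp : p.natDegree < e * l.length) :
    ∃ s : F, (l.map fun M : Matrix n n F[X] => M.map (eval s)).prod.trace = p.eval s := by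
  have htop : (l.prod.trace - p).coeff (e * l.length) ≠ 0 := by
    rw [coeff_sub, coeff_eq_zero_of_natDegree_lt hp, sub_zero]
    have h := (ConcentratedInColumn.list_prod (l := l.map fun M => M.map (coeff · e)) (j := j)
      (by simpa using hl) (by simpa using hcol)).trace_ne_zero
    rw [← (map_coeff_list_prod e l hdeg).2] at h
    simpa [Matrix.trace, finsetSum_coeff] using h
  obtain ⟨s, hs⟩ := IsAlgClosed.exists_root (l.prod.trace - p) fun h => by
    have := le_natDegree_of_ne_zero htop
    rw [natDegree_eq_zero_iff_degree_le_zero.2 h.le] at this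
    omega
  refine ⟨s, ?_⟩
  rw [IsRoot.def, eval_sub, sub_eq_zero] at hs
  rw [← hs, ← coe_evalRingHom, AddMonoidHom.map_trace (evalRingHom s)]
  congr 1
  exact (map_list_prod (evalRingHom s).mapMatrix l).symm

theorem entry_one_zero_ne_zero {C A : SL(2, ℂ)} (hA : A 1 0 = 0)
    (h : Matrix.trace ((C * A * C⁻¹ * A⁻¹ : SL(2, ℂ)) : Matrix (Fin 2) (Fin 2) ℂ) ≠ 2) :
    C 1 0 ≠ 0 := by
  intro hC
  refine h ?_
  have h1 := C.det_coe
  have h2 := A.det_coe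
  rw [Matrix.det_fin_two] at h1 h2
  simp only [Matrix.SpecialLinearGroup.coe_mul, Matrix.SpecialLinearGroup.coe_inv,
    Matrix.adjugate_fin_two, Matrix.trace_fin_two, Matrix.mul_apply, Fin.sum_univ_two,
    Matrix.of_apply, Matrix.cons_val', Matrix.cons_val_zero, Matrix.cons_val_one,
    Matrix.cons_val_fin_one, hA, hC] at *
  linear_combination 2 * (C 0 0 * C 1 1) * h2 + 2 * h1

theorem entry_zero_one_ne_zero {C A : SL(2, ℂ)} (hA : A 0 1 = 0)
    (h : Matrix.trace ((C * A * C⁻¹ * A⁻¹ : SL(2, ℂ)) : Matrix (Fin 2) (Fin 2) ℂ) ≠ 2) :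
    C 0 1 ≠ 0 := by
  intro hC
  refine h ?_
  have h1 := C.det_coe
  have h2 := A.det_coe
  rw [Matrix.det_fin_two] at h1 h2
  simp only [Matrix.SpecialLinearGroup.coe_mul, Matrix.SpecialLinearGroup.coe_inv,
    Matrix.adjugate_fin_two, Matrix.trace_fin_two, Matrix.mul_apply, Fin.sum_univ_two,
    Matrix.of_apply, Matrix.cons_val', Matrix.cons_val_zero, Matrix.cons_val_one,
    Matrix.cons_val_fin_one, hA, hC] at *
  linear_combination 2 * (C 0 0 * C 1 1) * h2 + 2 * h1

theorem coe_conj_fin_two {S : Type*} [CommRing S] (P A : SL(2, S)) :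
    ((P * A * P⁻¹ : SL(2, S)) : Matrix (Fin 2) (Fin 2) S) =
      !![(P 0 0 * A 0 0 + P 0 1 * A 1 0) * P 1 1 - (P 0 0 * A 0 1 + P 0 1 * A 1 1) * P 1 0,
        (P 0 0 * A 0 1 + P 0 1 * A 1 1) * P 0 0 - (P 0 0 * A 0 0 + P 0 1 * A 1 0) * P 0 1;
        (P 1 0 * A 0 0 + P 1 1 * A 1 0) * P 1 1 - (P 1 0 * A 0 1 + P 1 1 * A 1 1) * P 1 0,
        (P 1 0 * A 0 1 + P 1 1 * A 1 1) * P 0 0 - (P 1 0 * A 0 0 + P 1 1 * A 1 0) * P 0 1] := by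
  rw [Matrix.SpecialLinearGroup.coe_mul, Matrix.SpecialLinearGroup.coe_mul,
    Matrix.SpecialLinearGroup.coe_inv, Matrix.adjugate_fin_two]
  ext i j
  fin_cases i <;> fin_cases j <;> simp [Matrix.mul_apply, Fin.sum_univ_two] <;> ring

theorem exists_coe_eq {S : Type*} [CommRing S] (M : Matrix (Fin 2) (Fin 2) S) (hM : M.det = 1) :
    ∃ U : SL(2, S), (U : Matrix (Fin 2) (Fin 2) S) = M :=
  ⟨⟨M, hM⟩, rfl⟩

theorem trace_conj {S : Type*} [CommRing S] (P A : SL(2, S)) :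
    ((P * A * P⁻¹ : SL(2, S)) : Matrix (Fin 2) (Fin 2) S).trace =
      (A : Matrix (Fin 2) (Fin 2) S).trace := by
  rw [Matrix.SpecialLinearGroup.coe_mul, Matrix.trace_mul_comm,
    ← Matrix.SpecialLinearGroup.coe_mul, ← mul_assoc, inv_mul_cancel, one_mul]

/-- Jordan form in `SL(2, ℂ)`. -/
theorem exists_conj_upper_triangular (A : SL(2, ℂ)) :
    ∃ P : SL(2, ℂ), (P * A * P⁻¹) 1 0 = 0 ∧
      ((P * A * P⁻¹) 0 1 = 0 ∨ (P * A * P⁻¹) 0 0 = (P * A * P⁻¹) 1 1) := by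
  obtain ⟨P, hP⟩ : ∃ P : SL(2, ℂ), (P * A * P⁻¹) 1 0 = 0 := by
    by_cases h : A 0 1 = 0
    · obtain ⟨U, hU⟩ := exists_coe_eq (!![0, 1; -1, 0] : Matrix (Fin 2) (Fin 2) ℂ)
        (by simp [Matrix.det_fin_two])
      exact ⟨U, by rw [coe_conj_fin_two]; simp [hU, h]⟩
    · obtain ⟨r, hr⟩ := IsAlgClosed.exists_pow_nat_eq (discrim (-A 0 1) (A 0 0 - A 1 1) (A 1 0))
        two_pos
      obtain ⟨x, hx⟩ := exists_quadratic_eq_zero (neg_ne_zero.2 h) ⟨r, by rw [← hr, sq]⟩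
      obtain ⟨U, hU⟩ := exists_coe_eq (!![1, 0; x, 1] : Matrix (Fin 2) (Fin 2) ℂ)
        (by simp [Matrix.det_fin_two])
      refine ⟨U, ?_⟩
      simp only [coe_conj_fin_two, hU, Matrix.of_apply, Matrix.cons_val', Matrix.cons_val_zero,
        Matrix.cons_val_one, Matrix.cons_val_fin_one]
      linear_combination hx
  by_cases h : (P * A * P⁻¹) 0 0 = (P * A * P⁻¹) 1 1
  · exact ⟨P, hP, .inr h⟩
  have hconj (U : SL(2, ℂ)) : U * P * A * (U * P)⁻¹ = U * (P * A * P⁻¹) * U⁻¹ := by group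
  generalize P * A * P⁻¹ = B at hP h hconj
  obtain ⟨U, hU⟩ := exists_coe_eq
    (!![1, B 0 1 / (B 0 0 - B 1 1); 0, 1] : Matrix (Fin 2) (Fin 2) ℂ)
    (by simp [Matrix.det_fin_two])
  refine ⟨U * P, ?_⟩
  rw [hconj, coe_conj_fin_two]
  have h' := sub_ne_zero.2 h
  constructor
  · simp [hU, hP]
  · left
    simp [hU, hP]
    field_simp
    ring

theorem mk_pow_eq_one_iff_of_diagonal {B : SL(2, ℂ)} (h10 : B 1 0 = 0) (h01 : B 0 1 = 0) (n : ℕ) :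
    (QuotientGroup.mk B : PSL(2, ℂ)) ^ n = 1 ↔ (B 0 0 ^ 2) ^ n = 1 := by
  have hdet : B 0 0 * B 1 1 = 1 := by
    have h := B.det_coe
    rwa [Matrix.det_fin_two, h10, mul_zero, sub_zero] at h
  have hdet' : B 0 0 ^ n * B 1 1 ^ n = 1 := by rw [← mul_pow, hdet, one_pow]
  have hB : (B : Matrix (Fin 2) (Fin 2) ℂ) = Matrix.diagonal ![B 0 0, B 1 1] := by
    ext i j
    fin_cases i <;> fin_cases j <;> simp [h10, h01]
  have hBn : ((B ^ n : SL(2, ℂ)) : Matrix (Fin 2) (Fin 2) ℂ) =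
      Matrix.diagonal ![B 0 0 ^ n, B 1 1 ^ n] := by
    rw [Matrix.SpecialLinearGroup.coe_pow, hB, Matrix.diagonal_pow]
    congr 1
    ext i
    fin_cases i <;> simp
  have hn : (B 0 0 ^ 2) ^ n = B 0 0 ^ n * B 0 0 ^ n := by ring
  rw [← QuotientGroup.mk_pow, QuotientGroup.eq_one_iff, Matrix.SpecialLinearGroup.mem_center_iff,
    hBn, hn]
  simp only [Matrix.scalar_apply, Matrix.diagonal_eq_diagonal_iff, Fin.forall_fin_two,
    Matrix.cons_val_zero, Matrix.cons_val_one, Fintype.card_fin]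
  constructor
  · rintro ⟨r, hr, h0, h1⟩
    rw [← h0, ← sq, hr]
  · intro h
    refine ⟨B 0 0 ^ n, by rw [sq, h], rfl, mul_left_cancel₀ (left_ne_zero_of_mul_eq_one h) ?_⟩
    rw [h, hdet']

/-- A matrix of trace `ζ + ζ⁻¹`, where `ζ ^ 2` is a primitive `m`-th root of unity with `m ≥ 2`,
has order `m` in `PSL(2, ℂ)`. -/
theorem orderOf_mk_eq_of_trace_eq {ζ : ℂ} {m : ℕ} (hm : 2 ≤ m) (hζ : IsPrimitiveRoot (ζ ^ 2) m)
    {M : SL(2, ℂ)} (hM : Matrix.trace (M : Matrix (Fin 2) (Fin 2) ℂ) = ζ + ζ⁻¹) :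
    orderOf (QuotientGroup.mk M : PSL(2, ℂ)) = m := by
  obtain ⟨P, h10, h⟩ := exists_conj_upper_triangular M
  have hζ0 : ζ ≠ 0 := fun h => hζ.ne_zero (by omega) (by simp [h])
  have htr : (P * M * P⁻¹) 0 0 + (P * M * P⁻¹) 1 1 = ζ + ζ⁻¹ := by
    rw [← hM, ← trace_conj P, Matrix.trace_fin_two]
  have hconj : orderOf (QuotientGroup.mk (P * M * P⁻¹) : PSL(2, ℂ)) =
      orderOf (QuotientGroup.mk M : PSL(2, ℂ)) :=
    (MulAut.conj (QuotientGroup.mk P : PSL(2, ℂ))).orderOf_eq (QuotientGroup.mk M)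
  rw [← hconj]
  have hdet := (P * M * P⁻¹).det_coe
  generalize P * M * P⁻¹ = B at h10 h htr hdet
  rw [Matrix.det_fin_two, h10, mul_zero, sub_zero] at hdet
  have hα : (B 0 0 - ζ) * (B 0 0 - ζ⁻¹) = 0 := by
    linear_combination B 0 0 * htr - hdet + mul_inv_cancel₀ hζ0
  have hα' : B 0 0 = ζ ∨ B 0 0 = ζ⁻¹ := by simpa [sub_eq_zero] using hα
  have hprim : IsPrimitiveRoot (B 0 0 ^ 2) m := by
    obtain h | h := hα' <;> rw [h]
    · exact hζ
    · simpa using hζ.inv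
  have h01 : B 0 1 = 0 := by
    refine h.resolve_right fun h => hprim.ne_one (by omega) ?_
    rw [sq]
    nth_rewrite 2 [h]
    exact hdet
  rw [hprim.eq_orderOf, orderOf_eq_orderOf_iff]
  exact mk_pow_eq_one_iff_of_diagonal h10 h01

open Polynomial in
theorem exists_trace_ofFn_mul_eq {k : ℕ} (hk : 1 ≤ k) (C : Fin k → Matrix (Fin 2) (Fin 2) ℂ)
    (E : Fin k → Matrix (Fin 2) (Fin 2) ℂ[X]) (hC : ∀ i, C i 1 0 ≠ 0)
    (hE : ∀ i j j', (E i j j').natDegree ≤ 2)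
    (hE' : ∀ i, ∃ x ≠ 0, (E i).map (coeff · 2) = !![0, x; 0, 0]) (p : ℂ[X])
    (hp : p.natDegree < 2 * k) :
    ∃ s : ℂ, (List.ofFn fun i => C i * (E i).map (eval s)).prod.trace = p.eval s := by
  let F : Fin k → Matrix (Fin 2) (Fin 2) ℂ[X] := fun i => (C i).map Polynomial.C * E i
  obtain ⟨s, hs⟩ := exists_trace_list_prod_eq 1 2 (List.ofFn F)
    (by simpa [List.ofFn_eq_nil_iff] using (by omega : k ≠ 0))
    (by
      simp only [List.forall_mem_ofFn_iff]
      intro i j j'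
      simp only [F, Matrix.mul_apply]
      exact natDegree_sum_le_of_forall_le _ _ fun x _ => (natDegree_C_mul_le _ _).trans (hE _ _ _))
    (by
      simp only [List.forall_mem_ofFn_iff]
      intro i
      obtain ⟨x, hx, hEx⟩ := hE' i
      have hF : (F i).map (coeff · 2) = C i * (E i).map (coeff · 2) := by
        ext j j'
        simp [F, Matrix.mul_apply]
      rw [hF, hEx]
      constructor
      · simp [Fin.forall_fin_two, Matrix.mul_apply, Fin.sum_univ_two]
      · simpa [Matrix.mul_apply, Fin.sum_univ_two] using ⟨hC i, hx⟩)
    p (by simpa using hp)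
  refine ⟨s, ?_⟩
  rw [← hs, List.map_ofFn]
  congr 3
  funext i
  exact ((Matrix.map_mul (f := evalRingHom s)).trans (by ext; simp [Matrix.mul_apply])).symm

open Polynomial in
theorem exists_trace_eq_of_upper_triangular {k : ℕ} (hk : 1 ≤ k) (A : SL(2, ℂ))
    (h10 : A 1 0 = 0) (h : A 0 1 = 0 ∨ A 0 0 = A 1 1) (C D : Fin k → SL(2, ℂ))
    (hC : ∀ i, Matrix.trace
      ((C i * A * (C i)⁻¹ * A⁻¹ : SL(2, ℂ)) : Matrix (Fin 2) (Fin 2) ℂ) ≠ 2)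
    (hD : ∀ i, Matrix.trace
      ((D i * A * (D i)⁻¹ * A⁻¹ : SL(2, ℂ)) : Matrix (Fin 2) (Fin 2) ℂ) ≠ 2) (r : ℂ) :
    ∃ T : SL(2, ℂ), T * A = A * T ∧ Matrix.trace
      (((List.ofFn fun i => C i * (T * D i * T⁻¹)).prod : SL(2, ℂ)) :
        Matrix (Fin 2) (Fin 2) ℂ) = r := by
  have hprod (T : SL(2, ℂ)) :
      (((List.ofFn fun i => C i * (T * D i * T⁻¹)).prod : SL(2, ℂ)) : Matrix (Fin 2) (Fin 2) ℂ) =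
        (List.ofFn fun i => (C i : Matrix (Fin 2) (Fin 2) ℂ) *
          (T * D i * T⁻¹ : SL(2, ℂ))).prod := by
    refine (map_list_prod
      (Matrix.SpecialLinearGroup.coeMonoidHom (ι := Fin 2) (R := ℂ)) _).trans ?_
    rw [List.map_ofFn]
    congr 2
  have hC10 i := entry_one_zero_ne_zero h10 (hC i)
  have hD10 i := entry_one_zero_ne_zero h10 (hD i)
  rcases h with h01 | h00
  · have hC01 i := entry_zero_one_ne_zero h01 (hC i)
    have hD01 i := entry_zero_one_ne_zero h01 (hD i)
    obtain ⟨s, hs⟩ := exists_trace_ofFn_mul_eq hk (fun i => C i)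
      (fun i => !![Polynomial.C (D i 0 0) * X, Polynomial.C (D i 0 1) * X ^ 2;
        Polynomial.C (D i 1 0), Polynomial.C (D i 1 1) * X]) hC10
      (by
        simp only [Fin.forall_fin_two, Matrix.of_apply, Matrix.cons_val', Matrix.cons_val_zero,
          Matrix.cons_val_one, Matrix.cons_val_fin_one]
        intro i
        refine ⟨⟨?_, ?_⟩, ?_, ?_⟩ <;> compute_degree!)
      (fun i => ⟨D i 0 1, hD01 i, by
        ext j j'
        fin_cases j <;> fin_cases j' <;> simp⟩)
      (Polynomial.C r * X ^ k) ((natDegree_C_mul_X_pow_le _ _).trans_lt (by omega))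
    have hs0 : s ≠ 0 := by
      rintro rfl
      rw [eval_mul, eval_pow, eval_X, zero_pow (by omega), mul_zero] at hs
      refine (ConcentratedInColumn.list_prod (j := 0) ?_ ?_).trace_ne_zero hs
      · simpa [List.ofFn_eq_nil_iff] using (by omega : k ≠ 0)
      · simp only [List.forall_mem_ofFn_iff]
        intro i
        constructor
        · simp [Fin.forall_fin_two, Matrix.mul_apply, Fin.sum_univ_two]
        · simpa [Matrix.mul_apply, Fin.sum_univ_two] using ⟨hC01 i, hD10 i⟩
    obtain ⟨t, rfl⟩ := IsAlgClosed.exists_pow_nat_eq s two_pos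
    have ht : t ≠ 0 := fun h => hs0 (by simp [h])
    obtain ⟨T, hT⟩ := exists_coe_eq (!![t, 0; 0, t⁻¹] : Matrix (Fin 2) (Fin 2) ℂ)
      (by simp [Matrix.det_fin_two, ht])
    refine ⟨T, ?_, ?_⟩
    · rw [← mul_inv_eq_iff_eq_mul]
      ext i j
      rw [coe_conj_fin_two]
      fin_cases i <;> fin_cases j <;> simp [hT, h10, h01] <;> field_simp
    · have hsmul : (List.ofFn fun i => (C i : Matrix (Fin 2) (Fin 2) ℂ) *
          (!![Polynomial.C (D i 0 0) * X, Polynomial.C (D i 0 1) * X ^ 2;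
            Polynomial.C (D i 1 0), Polynomial.C (D i 1 1) * X]).map (eval (t ^ 2))) =
          (List.ofFn fun i => (C i : Matrix (Fin 2) (Fin 2) ℂ) *
            (T * D i * T⁻¹ : SL(2, ℂ))).map (t ^ 2 • ·) := by
        rw [List.map_ofFn]
        congr 1
        funext i
        rw [Function.comp_apply, coe_conj_fin_two, ← mul_smul_comm]
        congr 1
        ext j j'
        fin_cases j <;> fin_cases j' <;> simp [hT] <;> field_simp
      rw [hsmul, ← List.smul_prod, List.length_ofFn, Matrix.trace_smul, ← hprod] at hs
      refine mul_left_cancel₀ (pow_ne_zero k hs0) (hs.trans ?_)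
      rw [eval_mul, eval_C, eval_pow, eval_X, mul_comm]
  · obtain ⟨s, hs⟩ := exists_trace_ofFn_mul_eq hk (fun i => C i)
      (fun i => !![Polynomial.C (D i 0 0) + Polynomial.C (D i 1 0) * X,
          Polynomial.C (D i 0 1) + Polynomial.C (D i 1 1 - D i 0 0) * X
            + Polynomial.C (-D i 1 0) * X ^ 2;
          Polynomial.C (D i 1 0), Polynomial.C (D i 1 1) + Polynomial.C (-D i 1 0) * X]) hC10
      (by
        simp only [Fin.forall_fin_two, Matrix.of_apply, Matrix.cons_val', Matrix.cons_val_zero,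
          Matrix.cons_val_one, Matrix.cons_val_fin_one]
        intro i
        refine ⟨⟨?_, ?_⟩, ?_, ?_⟩ <;> compute_degree!)
      (fun i => ⟨-D i 1 0, neg_ne_zero.2 (hD10 i), by
        ext j j'
        fin_cases j <;> fin_cases j' <;> simp [-map_neg, -map_sub]⟩)
      (Polynomial.C r) (by rw [natDegree_C]; omega)
    obtain ⟨T, hT⟩ := exists_coe_eq (!![1, s; 0, 1] : Matrix (Fin 2) (Fin 2) ℂ)
      (by simp [Matrix.det_fin_two])
    refine ⟨T, ?_, ?_⟩
    · rw [← mul_inv_eq_iff_eq_mul]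
      ext i j
      rw [coe_conj_fin_two]
      fin_cases i <;> fin_cases j <;> simp [hT, h10, h00]
      ring
    · rw [eval_C] at hs
      rw [hprod, ← hs]
      congr 3
      funext i
      rw [coe_conj_fin_two]
      congr 1
      ext j j'
      fin_cases j <;> fin_cases j' <;> simp [hT] <;> ring

/-- Twisting by a suitable element of the centralizer of `A`, one can realize any trace. -/
theorem exists_commute_trace_eq {k : ℕ} (hk : 1 ≤ k) (A : SL(2, ℂ)) (C D : Fin k → SL(2, ℂ))
    (hC : ∀ i, Matrix.trace
      ((C i * A * (C i)⁻¹ * A⁻¹ : SL(2, ℂ)) : Matrix (Fin 2) (Fin 2) ℂ) ≠ 2)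
    (hD : ∀ i, Matrix.trace
      ((D i * A * (D i)⁻¹ * A⁻¹ : SL(2, ℂ)) : Matrix (Fin 2) (Fin 2) ℂ) ≠ 2) (r : ℂ) :
    ∃ T : SL(2, ℂ), T * A = A * T ∧ Matrix.trace
      (((List.ofFn fun i => C i * (T * D i * T⁻¹)).prod : SL(2, ℂ)) :
        Matrix (Fin 2) (Fin 2) ℂ) = r := by
  obtain ⟨P, h10, h⟩ := exists_conj_upper_triangular A
  have hcomm (B : SL(2, ℂ)) : P * B * P⁻¹ * (P * A * P⁻¹) * (P * B * P⁻¹)⁻¹ * (P * A * P⁻¹)⁻¹ =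
      P * (B * A * B⁻¹ * A⁻¹) * P⁻¹ := by group
  obtain ⟨T, hTA, hT⟩ := exists_trace_eq_of_upper_triangular hk (P * A * P⁻¹) h10 h
    (fun i => P * C i * P⁻¹) (fun i => P * D i * P⁻¹)
    (fun i => by rw [hcomm, trace_conj]; exact hC i)
    (fun i => by rw [hcomm, trace_conj]; exact hD i) r
  refine ⟨P⁻¹ * T * P, ?_, ?_⟩
  · have := congrArg (fun B => P⁻¹ * B * P) hTA
    simpa [mul_assoc] using this
  · rw [← hT, ← trace_conj P, ← MulAut.conj_apply, map_list_prod, List.map_ofFn]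
    congr 4
    funext i
    simp only [Function.comp_apply, MulAut.conj_apply]
    group

/-- **Freiheitssatz for one-relator amalgamated products.** Let
`G = G₁ *_A G₂` with `A = ⟨a⟩` cyclic, and let `R = c₁ d₁ ⋯ c_k d_k ∈ G ∖ A` be in reduced
form. If `G` has a representation `φ` into `PSL(2, ℂ)` faithful on `G₁` and `G₂` such that all
pairs `{φ(cᵢ), φ(a)}` and `{φ(dᵢ), φ(a)}` are irreducible, then for every `m ≥ 2` the quotient
`H = G/N(R^m)` has a representation `ρ` into `PSL(2, ℂ)` which is faithful on (the images of)
`G₁` and `G₂` and such that `ρ(R)` has order exactly `m`; in particular `G₁ → H` and `G₂ → H`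
are injective. -/
theorem freiheitssatz_one_relator_amalgam (G : Type*) [Group G] (G₁ G₂ : Subgroup G) (a : G)
    (hAm : IsAmalgam G G₁ G₂ (Subgroup.zpowers a))
    (k : ℕ) (hk : 1 ≤ k) (c d : Fin k → G)
    (hc : ∀ i, c i ∈ G₁ ∧ c i ∉ Subgroup.zpowers a)
    (hd : ∀ i, d i ∈ G₂ ∧ d i ∉ Subgroup.zpowers a)
    (R : G) (hR : R = (List.ofFn fun i => c i * d i).prod) (hRA : R ∉ Subgroup.zpowers a)
    (φ : G →* PSL(2, ℂ))
    (hφ1 : Set.InjOn φ (G₁ : Set G)) (hφ2 : Set.InjOn φ (G₂ : Set G))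
    (hirr : ∀ i, IrreduciblePair (φ (c i)) (φ a) ∧ IrreduciblePair (φ (d i)) (φ a))
    (m : ℕ) (hm : 2 ≤ m) :
    ∃ ρ : G ⧸ Subgroup.normalClosure {R ^ m} →* PSL(2, ℂ),
      Set.InjOn (ρ.comp (QuotientGroup.mk' (Subgroup.normalClosure {R ^ m}))) (G₁ : Set G) ∧
      Set.InjOn (ρ.comp (QuotientGroup.mk' (Subgroup.normalClosure {R ^ m}))) (G₂ : Set G) ∧
      orderOf (ρ ((QuotientGroup.mk' (Subgroup.normalClosure {R ^ m})) R)) = m ∧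
      Set.InjOn (QuotientGroup.mk' (Subgroup.normalClosure {R ^ m})) (G₁ : Set G) ∧
      Set.InjOn (QuotientGroup.mk' (Subgroup.normalClosure {R ^ m})) (G₂ : Set G) := by
  obtain ⟨A, hA⟩ := QuotientGroup.mk_surjective (φ a)
  choose C hC using fun i => QuotientGroup.mk_surjective (φ (c i))
  choose D hD using fun i => QuotientGroup.mk_surjective (φ (d i))
  have hm0 : m ≠ 0 := by omega
  obtain ⟨ζ, hζ⟩ := IsAlgClosed.exists_pow_nat_eq (Complex.exp (2 * Real.pi * Complex.I / m))
    two_pos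
  have hprim : IsPrimitiveRoot (ζ ^ 2) m := hζ ▸ Complex.isPrimitiveRoot_exp m hm0
  obtain ⟨T, hTA, hT⟩ := exists_commute_trace_eq hk A C D
    (fun i => (hirr i).1 _ _ (hC i) hA) (fun i => (hirr i).2 _ _ (hD i) hA) (ζ + ζ⁻¹)
  let τ := MulAut.conj (QuotientGroup.mk T : PSL(2, ℂ))
  have hτa : τ (φ a) = φ a := by
    rw [MulAut.conj_apply, mul_inv_eq_iff_eq_mul, ← hA]
    exact congrArg QuotientGroup.mk hTA
  obtain ⟨ρ, hρ1, hρ2⟩ := hAm.exists_monoidHom (φ.comp G₁.subtype)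
    ((τ.toMonoidHom.comp φ).comp G₂.subtype) (by
      intro x h₁ h₂
      have hx : x ∈ Subgroup.zpowers a := hAm.1 ▸ ⟨h₁, h₂⟩
      obtain ⟨n, rfl⟩ := hx
      change φ (a ^ n) = τ (φ (a ^ n))
      rw [map_zpow, map_zpow, hτa])
  have hρR : ρ R = QuotientGroup.mk (List.ofFn fun i => C i * (T * D i * T⁻¹)).prod := by
    rw [hR, map_list_prod, List.map_ofFn]
    refine Eq.trans ?_ (map_list_prod (QuotientGroup.mk' (Subgroup.center SL(2, ℂ))) _).symm
    rw [List.map_ofFn]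
    congr 2
    funext i
    have h1 : ρ (c i) = φ (c i) := hρ1 ⟨c i, (hc i).1⟩
    have h2 : ρ (d i) = τ (φ (d i)) := hρ2 ⟨d i, (hd i).1⟩
    rw [Function.comp_apply, map_mul, h1, h2, ← hC, ← hD]
    rfl
  have horder : orderOf (ρ R) = m := by
    rw [hρR]
    exact orderOf_mk_eq_of_trace_eq hm hprim hT
  have hker : Subgroup.normalClosure {R ^ m} ≤ ρ.ker :=
    Subgroup.normalClosure_le_normal (by
      simp [MonoidHom.mem_ker, ← horder, pow_orderOf_eq_one])
  let ρ' := QuotientGroup.lift _ ρ hker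
  have hρ' : ρ'.comp (QuotientGroup.mk' _) = ρ := rfl
  have hinj1 : Set.InjOn ρ G₁ := fun x hx y hy hxy =>
    hφ1 hx hy ((hρ1 ⟨x, hx⟩).symm.trans (hxy.trans (hρ1 ⟨y, hy⟩)))
  have hinj2 : Set.InjOn ρ G₂ := fun x hx y hy hxy =>
    hφ2 hx hy (τ.injective ((hρ2 ⟨x, hx⟩).symm.trans (hxy.trans (hρ2 ⟨y, hy⟩))))
  exact ⟨ρ', hinj1, hinj2, horder, Set.InjOn.of_comp (g := ρ') hinj1,
    Set.InjOn.of_comp (g := ρ') hinj2⟩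

end FPaper
end
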